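/- The pseudovariety DO is κ-reducible for idempotent pointlike sets: let S be a finite semigroup and P a DO-idempotent pointlike subset of S. Then for every finite alphabet A and every surjective homomorphism φ: A⁺ → S from the free semigroup on A, there exists a family (w_p)_{p∈P} of κ-terms over A such that, for each p ∈ P, w_p evaluates to p in S under the letter assignment given by φ restricted to A, and for every finite semigroup T in DO and every map from A to T, all the terms w_p evaluate to one and the same idempotent element of T. -/

import Mathlib

/-- `spow s n` is the power `s^(n+1)` of `s`, defined in any magma. -/
def spow {S : Type*} [Mul S] (s : S) (n : ℕ) : S := (fun x => x * s)^[n] s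

/-- The two-sided ideal of a semigroup `T` generated by the element `s`. -/
def idealGen {T : Type} [Semigroup T] (s : T) : Set T :=
  {x | x = s ∨ (∃ u, x = s * u) ∨ (∃ u, x = u * s) ∨ ∃ u v, x = u * s * v}

/-- The `J`-class of `s`: the set of elements generating the same two-sided
ideal as `s`. -/
def jClass {T : Type} [Semigroup T] (s : T) : Set T :=
  {x | idealGen x = idealGen s}

/-- A rectangular band is a semigroup satisfying `x * y * x = x`. -/
def IsRectangularBand (B : Type) [Semigroup B] : Prop :=
  ∀ x y : B, x * y * x = x

/-- The subset `J` of `T`, which is assumed closed under multiplication, is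
isomorphic as a semigroup (with the induced multiplication) to `B × G`. -/
def IsIsoToProd {T : Type} [Semigroup T] (J : Set T)
    (B G : Type) [Semigroup B] [Group G] : Prop :=
  ∃ φ : ↥J → B × G, Function.Bijective φ ∧
    ∀ (x y : T) (hx : x ∈ J) (hy : y ∈ J) (hxy : x * y ∈ J),
      φ ⟨x * y, hxy⟩ = φ ⟨x, hx⟩ * φ ⟨y, hy⟩

/-- A finite semigroup `T` lies in `DO` if every regular `J`-class of `T`
(i.e. one containing an idempotent) is closed under multiplication and, with
the induced multiplication, is isomorphic to the direct product of a
rectangular band and a group. -/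
def InDO (T : Type) [Semigroup T] : Prop :=
  ∀ s : T, (∃ e ∈ jClass s, IsIdempotentElem e) →
    (∀ x ∈ jClass s, ∀ y ∈ jClass s, x * y ∈ jClass s) ∧
    ∃ (B G : Type) (iB : Semigroup B) (iG : Group G),
      @IsRectangularBand B iB ∧ @IsIsoToProd T _ (jClass s) B G iB iG

/-- κ-terms over the alphabet `A`: letters, binary multiplication and the
unary `(ω-1)`-power. -/
inductive KTerm (A : Type) : Type
  | letter : A → KTerm A
  | mul : KTerm A → KTerm A → KTerm A
  | ommPow : KTerm A → KTerm A

/-- The evaluation relation for κ-terms in a semigroup `T`, given an assignment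
`f` of letters.  The `(ω-1)`-power of an element `s` is the element `g` of the
cyclic subsemigroup generated by `s` such that `g * s = s * g = e` and
`g * e = g`, where `e` is the (unique, in a finite semigroup) idempotent power
`s^ω` of `s`. -/
inductive KEval {A T : Type} [Semigroup T] (f : A → T) : KTerm A → T → Prop
  | letter (a : A) : KEval f (KTerm.letter a) (f a)
  | mul {u v : KTerm A} {s t : T} :
      KEval f u s → KEval f v t → KEval f (KTerm.mul u v) (s * t)
  | ommPow {u : KTerm A} {s e g : T} :
      KEval f u s →
      IsIdempotentElem e → (∃ n : ℕ, spow s n = e) →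
      (∃ n : ℕ, spow s n = g) →
      g * s = e → s * g = e → g * e = g →
      KEval f (KTerm.ommPow u) g

/-- `P` is idempotent pointlike for the pseudovariety `DO`: for every finite
semigroup `T` in `DO` and every subsemigroup `R` of `S × T` projecting onto
`S`, some idempotent `t ∈ T` is related to every element of `P`. -/
def IsDOIdempotentPointlike {S : Type} [Semigroup S] (P : Set S) : Prop :=
  ∀ (T : Type) [Semigroup T] [Finite T], InDO T →
    ∀ R : Subsemigroup (S × T),
      (∀ s : S, ∃ t : T, (s, t) ∈ R) →
      ∃ t : T, IsIdempotentElem t ∧ ∀ p ∈ P, (p, t) ∈ R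



namespace AshPart
open Classical

variable {A Q : Type}

/-- one step in the product of a labelled graph with a Cayley graph -/
def Adj {G : Type} [Group G] (step : Q → A → Q → Prop) (p : A → G) (x y : G × Q) : Prop :=
  ∃ a, step x.2 a y.2 ∧ y.1 = x.1 * p a

/-- being in the same piece -/
def Conn {G : Type} [Group G] (step : Q → A → Q → Prop) (p : A → G) : G × Q → G × Q → Prop :=
  Relation.EqvGen (Adj step p)

variable {step : Q → A → Q → Prop}

lemma Conn.refl {G : Type} [Group G] {p : A → G} (x : G × Q) : Conn step p x x :=
  Relation.EqvGen.refl x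
lemma Conn.symm {G : Type} [Group G] {p : A → G} {x y : G × Q} (h : Conn step p x y) :
    Conn step p y x := Relation.EqvGen.symm _ _ h
lemma Conn.trans {G : Type} [Group G] {p : A → G} {x y z : G × Q} (h : Conn step p x y)
    (h' : Conn step p y z) : Conn step p x z := Relation.EqvGen.trans _ _ _ h h'
lemma Conn.edge {G : Type} [Group G] {p : A → G} {g : G} {q r : Q} {a : A}
    (h : step q a r) : Conn step p (g, q) (g * p a, r) := Relation.EqvGen.rel _ _ ⟨a, h, rfl⟩

lemma Conn.map {G G' : Type} [Group G] [Group G'] {p : A → G} {p' : A → G'} (θ : G →* G')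
    (hθ : ∀ a, θ (p a) = p' a) {x y : G × Q} (h : Conn step p x y) :
    Conn step p' (θ x.1, x.2) (θ y.1, y.2) := by
  induction h with
  | rel x y h =>
    obtain ⟨a, ha, hy⟩ := h
    exact Relation.EqvGen.rel _ _ ⟨a, ha, by simp [hy, hθ]⟩
  | refl x => exact Conn.refl _
  | symm x y _ ih => exact ih.symm
  | trans x y z _ _ ih1 ih2 => exact ih1.trans ih2

lemma Conn.translate {G : Type} [Group G] {p : A → G} (t : G) {x y : G × Q}
    (h : Conn step p x y) : Conn step p (t * x.1, x.2) (t * y.1, y.2) := by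
  induction h with
  | rel x y h =>
    obtain ⟨a, ha, hy⟩ := h
    exact Relation.EqvGen.rel _ _ ⟨a, ha, by simp [hy, mul_assoc]⟩
  | refl x => exact Conn.refl _
  | symm x y _ ih => exact ih.symm
  | trans x y z _ _ ih1 ih2 => exact ih1.trans ih2

lemma Conn.reach {G : Type} [Group G] {p : A → G} {x y : G × Q}
    (h : Conn step p x y) : x.1⁻¹ * y.1 ∈ (FreeGroup.lift p).range := by
  induction h with
  | rel x y h =>
    obtain ⟨a, ha, hy⟩ := h
    exact ⟨FreeGroup.of a, by simp [hy]⟩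
  | refl x => simp
  | symm x y _ ih =>
    have := Subgroup.inv_mem _ ih
    simpa using this
  | trans x y z _ _ ih1 ih2 =>
    have := Subgroup.mul_mem _ ih1 ih2
    simpa [mul_assoc] using this

/-- the mod 2 abelian expansion of a group -/
@[ext] structure Ab (A G : Type) where
  g : G
  c : G → A → ZMod 2

variable {G : Type} [Group G]

instance : Group (Ab A G) where
  mul x y := ⟨x.g * y.g, fun h a => x.c h a + y.c (x.g⁻¹ * h) a⟩
  one := ⟨1, fun _ _ => 0⟩
  inv x := ⟨x.g⁻¹, fun h a => - x.c (x.g * h) a⟩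
  mul_assoc x y z := by
    apply Ab.ext
    · exact mul_assoc _ _ _
    · funext h a
      change (x.c h a + y.c (x.g⁻¹ * h) a) + z.c ((x.g * y.g)⁻¹ * h) a =
        x.c h a + (y.c (x.g⁻¹ * h) a + z.c (y.g⁻¹ * (x.g⁻¹ * h)) a)
      rw [add_assoc]; simp [mul_assoc]
  one_mul x := by
    apply Ab.ext
    · exact one_mul _
    · funext h a
      change 0 + x.c (1⁻¹ * h) a = _
      simp
  mul_one x := by
    apply Ab.ext
    · exact mul_one _
    · funext h a
      change x.c h a + 0 = _
      simp
  inv_mul_cancel x := by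
    apply Ab.ext
    · exact inv_mul_cancel _
    · funext h a
      change - x.c (x.g * h) a + x.c (x.g⁻¹⁻¹ * h) a = 0
      rw [inv_inv]; exact neg_add_cancel _

@[simp] lemma Ab.mul_g (x y : Ab A G) : (x * y).g = x.g * y.g := rfl
@[simp] lemma Ab.one_g : (1 : Ab A G).g = 1 := rfl
@[simp] lemma Ab.inv_g (x : Ab A G) : (x⁻¹).g = x.g⁻¹ := rfl
lemma Ab.mul_c (x y : Ab A G) (h : G) (a : A) :
    (x * y).c h a = x.c h a + y.c (x.g⁻¹ * h) a := rfl

/-- projection -/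
def Ab.pr : Ab A G →* G where
  toFun x := x.g
  map_one' := rfl
  map_mul' _ _ := rfl

/-- generators of the expansion -/
noncomputable def Ab.gen (p : A → G) (a : A) : Ab A G :=
  ⟨p a, fun h b => if h = 1 ∧ b = a then 1 else 0⟩

lemma Ab.mul_gen_c (p : A → G) (x : Ab A G) (a : A) (h : G) (b : A) :
    (x * Ab.gen p a).c h b = x.c h b + if h = x.g ∧ b = a then 1 else 0 := by
  rw [Ab.mul_c]
  have : (x.g⁻¹ * h = 1) ↔ h = x.g := by
    rw [inv_mul_eq_one, eq_comm]
  simp [Ab.gen, this]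

instance [Finite A] [Finite G] : Finite (Ab A G) :=
  Finite.of_injective (fun x : Ab A G => (x.g, x.c)) (fun x y h => by
    simp only [Prod.mk.injEq] at h
    exact Ab.ext h.1 h.2)

/-- an edge is traversed by the projection of a piece -/
def Cross (step : Q → A → Q → Prop) (p : A → G) (x : G × Q) (g : G) (a : A) : Prop :=
  ∃ r s, step r a s ∧ Conn step p x (g, r)

/-- projection of a point -/
def prj (x : Ab A G × Q) : G × Q := (x.1.g, x.2)

lemma Conn.prj {p : A → G} {x y : Ab A G × Q} (h : Conn step (Ab.gen p) x y) :
    Conn step p (prj x) (prj y) :=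
  Conn.map (Ab.pr) (fun _ => rfl) h

lemma cross_or {p : A → G} (g : G) (a : A) {x y : Ab A G × Q}
    (h : Conn step (Ab.gen p) x y) : Cross step p (prj x) g a ∨ x.1.c g a = y.1.c g a := by
  induction h with
  | rel x y h =>
    obtain ⟨b, hb, hy⟩ := h
    by_cases hc : g = x.1.g ∧ a = b
    · left
      obtain ⟨rfl, rfl⟩ := hc
      exact ⟨x.2, y.2, hb, Conn.refl _⟩
    · right
      rw [hy, Ab.mul_gen_c, if_neg hc, add_zero]
  | refl x => right; rfl
  | symm x y h ih =>
    rcases ih with ⟨r, s, h1, h2⟩ | ih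
    · left
      exact ⟨r, s, h1, (Conn.prj (Conn.symm h)).trans h2⟩
    · exact Or.inr ih.symm
  | trans x y z h h' ih1 ih2 =>
    rcases ih1 with ih1 | ih1
    · exact Or.inl ih1
    · rcases ih2 with ⟨r, s, h1, h2⟩ | ih2
      · left
        exact ⟨r, s, h1, (Conn.prj h).trans h2⟩
      · exact Or.inr (ih1.trans ih2)

/-- indicator function -/
noncomputable def ind (D : Set G) (x : G) : ZMod 2 := if x ∈ D then 1 else 0

lemma flux [Fintype A] [Fintype G] (p : A → G) (D : Set G) (w : FreeGroup A) : ∀ x : Ab A G,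
    ∑ g : G, ∑ a : A, ((x * FreeGroup.lift (Ab.gen p) w).c g a - x.c g a) *
      (ind D (g * p a) - ind D g) = ind D (x * FreeGroup.lift (Ab.gen p) w).g - ind D x.g := by
  have key : ∀ (a : A) (x : Ab A G), ∑ g : G, ∑ b : A,
      ((x * Ab.gen p a).c g b - x.c g b) *
      (ind D (g * p b) - ind D g) = ind D (x * Ab.gen p a).g - ind D x.g := by
    intro a x
    simp only [Ab.mul_gen_c, add_sub_cancel_left]
    rw [Finset.sum_eq_single x.g, Finset.sum_eq_single a]
    · simp [Ab.gen]
    · intro b _ hb; simp [hb]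
    · simp
    · intro g _ hg
      simp [hg]
    · simp
  induction w using FreeGroup.induction_on with
  | C1 => intro x; simp
  | of a => intro x; simpa using key a x
  | inv_of a _ =>
    intro x
    have := key a (x * (Ab.gen p a)⁻¹)
    simp only [inv_mul_cancel_right] at this
    simp only [map_inv, FreeGroup.lift_apply_of]
    rw [← neg_inj, neg_sub, ← this, ← Finset.sum_neg_distrib]
    refine Finset.sum_congr rfl fun g _ => ?_
    rw [← Finset.sum_neg_distrib]
    refine Finset.sum_congr rfl fun b _ => ?_
    ring
  | mul u v hu hv =>
    intro x
    have h1 := hu x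
    have h2 := hv (x * FreeGroup.lift (Ab.gen p) u)
    rw [map_mul, ← mul_assoc]
    rw [← sub_add_sub_cancel _ (ind D (x * FreeGroup.lift (Ab.gen p) u).g), ← h1, ← h2,
      ← Finset.sum_add_distrib]
    refine Finset.sum_congr rfl fun g _ => ?_
    rw [← Finset.sum_add_distrib]
    refine Finset.sum_congr rfl fun b _ => ?_
    ring

lemma separation [Finite A] [Finite G] (p : A → G) (D : Set G) (x y : Ab A G)
    (hxy : x⁻¹ * y ∈ (FreeGroup.lift (Ab.gen p)).range) (hx : x.g ∈ D) (hy : y.g ∉ D) :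
    ∃ g a, x.c g a ≠ y.c g a ∧ ¬ (g ∈ D ↔ g * p a ∈ D) := by
  have := Fintype.ofFinite A
  have := Fintype.ofFinite G
  obtain ⟨w, hw⟩ := hxy
  by_contra hcon
  push Not at hcon
  have h := flux p D w x
  rw [hw, mul_inv_cancel_left] at h
  rw [Finset.sum_eq_zero] at h
  · simp [ind, hx, hy] at h
  · intro g _
    refine Finset.sum_eq_zero fun a _ => ?_
    by_cases hc : x.c g a = y.c g a
    · simp [hc]
    · have := hcon g a hc
      simp [ind, this]

/-- lifting statement at a given level -/
def L (step : Q → A → Q → Prop) (p : A → G) (m : ℕ) : Prop :=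
  ∀ (E : Finset (G × Q)) (v : G), v ∈ (FreeGroup.lift p).range →
    (∀ x ∈ E, x.1 ∈ (FreeGroup.lift p).range) →
    (E.filter (fun x => ∀ r, ¬ Conn step p x (v, r))).card ≤ m →
    ∃ σ : G → FreeGroup A, ∀ x ∈ E, ∀ y, Conn step p x y →
      Conn step FreeGroup.of (σ x.1, x.2) (σ y.1, y.2)

lemma lift_gen_g (p : A → G) (w : FreeGroup A) :
    (FreeGroup.lift (Ab.gen p) w).g = FreeGroup.lift p w := by
  have : (Ab.pr : Ab A G →* G).comp (FreeGroup.lift (Ab.gen p)) = FreeGroup.lift p := by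
    ext a; simp [Ab.pr, Ab.gen]
  exact DFunLike.congr_fun this w

lemma range_pr {p : A → G} {x : Ab A G} (h : x ∈ (FreeGroup.lift (Ab.gen p)).range) :
    x.g ∈ (FreeGroup.lift p).range := by
  obtain ⟨w, rfl⟩ := h
  exact ⟨w, (lift_gen_g p w).symm⟩

lemma L_zero [Finite A] [Finite G] (p : A → G)
    (hp : ∀ (x : G) (r s : Q), Conn step p (x, r) (x, s) →
      Conn step FreeGroup.of ((1 : FreeGroup A), r) (1, s)) :
    L step (Ab.gen p) 0 := by
  intro E v hv hE hcard
  rw [Nat.le_zero, Finset.card_eq_zero, Finset.filter_eq_empty_iff] at hcard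
  push Not at hcard
  -- reachability through the support
  let Rch : Ab A G → G × FreeGroup A → G × FreeGroup A → Prop := fun y =>
    Relation.EqvGen (fun s t => ∃ a, v.c s.1 a ≠ y.c s.1 a ∧ t = (s.1 * p a, s.2 * FreeGroup.of a))
  have hR : ∀ y : Ab A G, ∃ u, y ∈ (FreeGroup.lift (Ab.gen p)).range →
      Rch y (v.g, 1) (y.g, u) := by
    intro y
    by_cases hy : y ∈ (FreeGroup.lift (Ab.gen p)).range
    swap
    · exact ⟨1, fun h => absurd h hy⟩
    by_contra hcon
    push Not at hcon
    obtain ⟨g, a, h1, h2⟩ := separation p {x | ∃ u, Rch y (v.g, 1) (x, u)} v y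
      (Subgroup.mul_mem _ (Subgroup.inv_mem _ hv) hy) ⟨1, Relation.EqvGen.refl _⟩
      (by rintro ⟨u, hu⟩; exact (hcon u).2 hu)
    apply h2
    constructor
    · rintro ⟨u, hu⟩
      exact ⟨u * FreeGroup.of a, hu.trans _ _ _ (Relation.EqvGen.rel _ _ ⟨a, h1, rfl⟩)⟩
    · rintro ⟨u, hu⟩
      refine ⟨u * (FreeGroup.of a)⁻¹, hu.trans _ _ _ (Relation.EqvGen.symm _ _ ?_)⟩
      exact Relation.EqvGen.rel _ _ ⟨a, h1, by simp⟩
  choose σ hσ using hR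
  have main : ∀ (x : Ab A G × Q) (r : Q), x.1 ∈ (FreeGroup.lift (Ab.gen p)).range →
      Conn step (Ab.gen p) (v, r) x → Conn step FreeGroup.of (1, r) (σ x.1, x.2) := by
    intro x r hx hc
    have hh := hσ x.1 hx
    -- transport along the support
    have tr : ∀ s t : G × FreeGroup A, Rch x.1 s t →
        ((∃ r', Conn step p (v.g, r) (s.1, r') ∧ Conn step FreeGroup.of (1, r) (s.2, r')) ↔
        (∃ r', Conn step p (v.g, r) (t.1, r') ∧ Conn step FreeGroup.of (1, r) (t.2, r'))) := by
      intro s t hst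
      induction hst with
      | rel s t h =>
        obtain ⟨a, ha, rfl⟩ := h
        obtain ⟨r1, r2, h1, h2⟩ := (cross_or s.1 a hc).resolve_right ha
        constructor
        · rintro ⟨r', h3, h4⟩
          refine ⟨r2, h2.trans (Conn.edge h1), ?_⟩
          have := (hp _ _ _ (h3.symm.trans h2)).translate s.2
          simp only [mul_one] at this
          exact (h4.trans this).trans (Conn.edge h1)
        · rintro ⟨r', h3, h4⟩
          refine ⟨r1, h2, ?_⟩
          have := (hp _ _ _ (h3.symm.trans (h2.trans (Conn.edge h1)))).translate
            (s.2 * FreeGroup.of a)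
          simp only [mul_one] at this
          exact (h4.trans this).trans (Conn.edge h1).symm
      | refl => rfl
      | symm _ _ _ ih => exact ih.symm
      | trans _ _ _ _ _ ih1 ih2 => exact ih1.trans ih2
    obtain ⟨r', h3, h4⟩ := (tr _ _ hh).1 ⟨r, Conn.refl _, Conn.refl _⟩
    have := (hp _ _ _ (h3.symm.trans (Conn.prj hc))).translate (σ x.1)
    simp only [mul_one] at this
    exact h4.trans this
  refine ⟨σ, fun x hx y hxy => ?_⟩
  obtain ⟨r, hr⟩ := hcard hx
  have hxr := hE x hx
  have hyr : y.1 ∈ (FreeGroup.lift (Ab.gen p)).range := by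
    have := Subgroup.mul_mem _ hxr hxy.reach
    simpa using this
  exact (main x r hxr hr.symm).symm.trans (main y r hyr (hr.symm.trans hxy))

lemma L_succ [Finite A] [Finite G] (p : A → G) (m : ℕ) (hL : L step p m) :
    L step (Ab.gen p) (m + 1) := by
  intro E v hv hE hcard
  by_cases hall : ∀ x ∈ E, ∃ r, Conn step p (prj x) (v.g, r)
  · obtain ⟨σ, hσ⟩ := hL (E.image prj) v.g (range_pr hv) (by
      intro x hx
      obtain ⟨y, hy, rfl⟩ := Finset.mem_image.1 hx
      exact range_pr (hE y hy)) (by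
      rw [Finset.card_eq_zero.2]
      · exact Nat.zero_le _
      · rw [Finset.filter_eq_empty_iff]
        intro x hx
        obtain ⟨y, hy, rfl⟩ := Finset.mem_image.1 hx
        push Not
        exact hall y hy)
    exact ⟨fun x => σ x.g, fun x hx y hxy => hσ _ (Finset.mem_image_of_mem _ hx) _ hxy.prj⟩
  push Not at hall
  obtain ⟨j, hj, hvj⟩ := hall
  obtain ⟨f, a, hfa, hD⟩ := separation p {x | ∀ r, ¬ Conn step p (prj j) (x, r)} v j.1
    (Subgroup.mul_mem _ (Subgroup.inv_mem _ hv) (hE j hj)) hvj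
    (by intro h; exact h j.2 (Conn.refl _))
  have hjc : ¬ Cross step p (prj j) f a := by
    rintro ⟨r, s, h1, h2⟩
    apply hD
    constructor
    · intro h; exact absurd h2 (h r)
    · intro h; exact absurd (h2.trans (Conn.edge h1)) (h s)
  obtain ⟨z, hz, hzj⟩ : ∃ z, (z = f ∨ z = f * p a) ∧ ∃ r, Conn step p (prj j) (z, r) := by
    by_contra hcon
    push Not at hcon
    apply hD
    exact ⟨fun _ => hcon _ (Or.inr rfl), fun _ => hcon _ (Or.inl rfl)⟩
  have hcz : ∀ x, Cross step p x f a → ∃ r, Conn step p x (z, r) := by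
    rintro x ⟨r, s, h1, h2⟩
    rcases hz with rfl | rfl
    · exact ⟨r, h2⟩
    · exact ⟨s, h2.trans (Conn.edge h1)⟩
  set E0 := E.filter (fun x => Cross step p (prj x) f a ∨ x.1.c f a = v.c f a) with hE0
  set E1 := E.filter (fun x => Cross step p (prj x) f a ∨ x.1.c f a ≠ v.c f a) with hE1
  have hbig : ((E.filter (fun x => ∀ r, ¬ Conn step (Ab.gen p) x (v, r))).erase j).card ≤ m := by
    rw [Finset.card_erase_of_mem]
    · omega
    · rw [Finset.mem_filter]
      exact ⟨hj, fun r hr => hvj r hr.prj⟩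
  have hrange : ∀ (E' : Finset (Ab A G × Q)), E' ⊆ E → ∀ x ∈ E'.image prj,
      x.1 ∈ (FreeGroup.lift p).range := by
    intro E' hE' x hx
    obtain ⟨y, hy, rfl⟩ := Finset.mem_image.1 hx
    exact range_pr (hE y (hE' hy))
  have hcount : ∀ (E' : Finset (Ab A G × Q)) (z : G),
      (∀ x ∈ E', (∀ r, ¬ Conn step p (prj x) (z, r)) →
        x ∈ (E.filter (fun x => ∀ r, ¬ Conn step (Ab.gen p) x (v, r))).erase j) →
      ((E'.image prj).filter (fun x => ∀ r, ¬ Conn step p x (z, r))).card ≤ m := by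
    intro E' z h
    refine le_trans ?_ hbig
    rw [Finset.filter_image]
    refine Finset.card_image_le.trans (Finset.card_le_card ?_)
    intro x hx
    rw [Finset.mem_filter] at hx
    exact h x hx.1 hx.2
  obtain ⟨σ0, hσ0⟩ := hL (E0.image prj) v.g (range_pr hv) (hrange E0 (Finset.filter_subset _ _))
    (hcount _ _ (by
      intro x hx hxv
      rw [hE0, Finset.mem_filter] at hx
      rw [Finset.mem_erase, Finset.mem_filter]
      refine ⟨?_, hx.1, fun r hr => hxv r hr.prj⟩
      rintro rfl
      rcases hx.2 with h | h
      · exact hjc h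
      · exact hfa h.symm))
  have hzr : z ∈ (FreeGroup.lift p).range := by
    obtain ⟨r, hr⟩ := hzj
    have := Subgroup.mul_mem _ (range_pr (hE j hj)) hr.reach
    simpa [prj] using this
  obtain ⟨σ1, hσ1⟩ := hL (E1.image prj) z hzr (hrange E1 (Finset.filter_subset _ _))
    (hcount _ _ (by
      intro x hx hxv
      rw [hE1, Finset.mem_filter] at hx
      rw [Finset.mem_erase, Finset.mem_filter]
      refine ⟨?_, hx.1, fun r hr => ?_⟩
      · rintro rfl
        obtain ⟨r, hr⟩ := hzj
        exact hxv r hr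
      · have hnc : ¬ Cross step p (prj x) f a := by
          intro h
          obtain ⟨r, hr⟩ := hcz _ h
          exact hxv r hr
        exact (hx.2.resolve_left hnc) ((cross_or f a hr).resolve_left hnc)))
  set t := σ0 z * (σ1 z)⁻¹ with ht
  refine ⟨fun y => if y.c f a = v.c f a then σ0 y.g else t * σ1 y.g, fun x hx y hxy => ?_⟩
  by_cases hc : Cross step p (prj x) f a
  · obtain ⟨r, hr⟩ := hcz _ hc
    have hx0 : prj x ∈ E0.image prj :=
      Finset.mem_image_of_mem _ (Finset.mem_filter.2 ⟨hx, Or.inl hc⟩)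
    have hx1 : prj x ∈ E1.image prj :=
      Finset.mem_image_of_mem _ (Finset.mem_filter.2 ⟨hx, Or.inl hc⟩)
    have key : ∀ y, Conn step (Ab.gen p) x y → Conn step FreeGroup.of (σ0 z, r)
        ((if y.1.c f a = v.c f a then σ0 y.1.g else t * σ1 y.1.g), y.2) := by
      intro y hy
      split_ifs
      · exact (hσ0 _ hx0 _ hr).symm.trans (hσ0 _ hx0 _ hy.prj)
      · have := ((hσ1 _ hx1 _ hr).symm.trans (hσ1 _ hx1 _ hy.prj)).translate t
        simpa [ht, prj] using this
    exact (key x (Conn.refl _)).symm.trans (key y hxy)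
  · have hcc := (cross_or f a hxy).resolve_left hc
    simp only [← hcc]
    split_ifs with h
    · exact hσ0 _ (Finset.mem_image_of_mem _ (Finset.mem_filter.2 ⟨hx, Or.inr h⟩)) _ hxy.prj
    · exact (hσ1 _ (Finset.mem_image_of_mem _ (Finset.mem_filter.2 ⟨hx, Or.inr h⟩)) _
        hxy.prj).translate t

/-- the folding equivalence -/
def foldSetoid (step : Q → A → Q → Prop) : Setoid Q where
  r q r := Conn step FreeGroup.of ((1 : FreeGroup A), q) (1, r)
  iseqv := ⟨fun _ => Conn.refl _, fun h => h.symm, fun h h' => h.trans h'⟩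

lemma base_level [Finite Q] (step : Q → A → Q → Prop) :
    ∃ (G : Type) (_ : Group G) (_ : Finite G) (p : A → G),
      ∀ (x : G) (r s : Q), Conn step p (x, r) (x, s) →
      Conn step FreeGroup.of ((1 : FreeGroup A), r) (1, s) := by
  let Q' := Quotient (foldSetoid step)
  let pi : Q → Q' := Quotient.mk _
  have ext : ∀ a : A, ∃ e : Equiv.Perm Q', ∀ q r, step q a r → e (pi r) = pi q := by
    intro a
    let dom : Q' → Prop := fun x => ∃ q r, step q a r ∧ pi r = x
    let img : Q' → Prop := fun x => ∃ q r, step q a r ∧ pi q = x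
    have hf : ∀ x : {x // dom x}, ∃ y : {y // img y}, ∃ q r, step q a r ∧ pi r = x.1 ∧ pi q = y.1 := by
      rintro ⟨x, q, r, h, rfl⟩
      exact ⟨⟨pi q, q, r, h, rfl⟩, q, r, h, rfl, rfl⟩
    choose f hf using hf
    have uniq : ∀ q r q' r', step q a r → step q' a r' → (pi r = pi r' ↔ pi q = pi q') := by
      intro q r q' r' h h'
      constructor
      · intro hh
        have hh : Conn step FreeGroup.of ((1 : FreeGroup A), r) (1, r') := Quotient.exact hh
        refine Quotient.sound (s := foldSetoid step)
          (show Conn step FreeGroup.of ((1 : FreeGroup A), q) (1, q') from ?_)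
        have h1 := (Conn.edge (p := FreeGroup.of) (g := (1 : FreeGroup A)) h)
        have h2 := (Conn.edge (p := FreeGroup.of) (g := (1 : FreeGroup A)) h')
        have h3 := hh.translate (1 * FreeGroup.of a)
        simp only [mul_one] at h3
        exact (h1.trans h3).trans h2.symm
      · intro hh
        have hh : Conn step FreeGroup.of ((1 : FreeGroup A), q) (1, q') := Quotient.exact hh
        refine Quotient.sound (s := foldSetoid step)
          (show Conn step FreeGroup.of ((1 : FreeGroup A), r) (1, r') from ?_)
        have h1 := (Conn.edge (p := FreeGroup.of) (g := (1 : FreeGroup A)) h)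
        have h2 := (Conn.edge (p := FreeGroup.of) (g := (1 : FreeGroup A)) h')
        have h3 := ((h1.symm.trans hh).trans h2).translate (FreeGroup.of a)⁻¹
        simpa using h3
    have hinj : Function.Injective f := by
      intro x y hxy
      obtain ⟨q, r, h1, h2, h3⟩ := hf x
      obtain ⟨q', r', h1', h2', h3'⟩ := hf y
      apply Subtype.ext
      rw [← h2, ← h2', uniq q r q' r' h1 h1', h3, h3', hxy]
    have hsurj : Function.Surjective f := by
      rintro ⟨y, q, r, h, rfl⟩
      refine ⟨⟨pi r, q, r, h, rfl⟩, ?_⟩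
      obtain ⟨q', r', h1', h2', h3'⟩ := hf ⟨pi r, q, r, h, rfl⟩
      apply Subtype.ext
      rw [← h3']
      exact (uniq _ _ _ _ h1' h).1 h2'
    have : Finite Q' := inferInstance
    have := Fintype.ofFinite Q'
    have hbij : Function.Bijective f := ⟨hinj, hsurj⟩
    refine ⟨(Equiv.ofBijective f hbij).extendSubtype, fun q r h => ?_⟩
    have hd : dom (pi r) := ⟨q, r, h, rfl⟩
    rw [Equiv.extendSubtype_apply_of_mem _ _ hd]
    change (f ⟨pi r, hd⟩ : Q') = pi q
    obtain ⟨q', r', h1', h2', h3'⟩ := hf ⟨pi r, hd⟩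
    rw [← h3']
    exact (uniq _ _ _ _ h1' h).1 h2'
  choose e he using ext
  refine ⟨Equiv.Perm Q', inferInstance, inferInstance, e, fun x r s h => ?_⟩
  have key : ∀ X Y : Equiv.Perm Q' × Q, Conn step e X Y → X.1 (pi X.2) = Y.1 (pi Y.2) := by
    intro X Y h
    induction h with
    | rel X Y h =>
      obtain ⟨a, ha, hY⟩ := h
      rw [hY, Equiv.Perm.mul_apply, he a _ _ ha]
    | refl => rfl
    | symm _ _ _ ih => exact ih.symm
    | trans _ _ _ _ _ ih1 ih2 => exact ih1.trans ih2
  have := x.injective (key _ _ h)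
  exact Quotient.exact this

/-- The lifting theorem (a form of the theorems of Ash and Herwig-Lascar). -/
theorem ash [Finite A] [Finite Q] (step : Q → A → Q → Prop) (m : ℕ) :
    ∃ (G : Type) (_ : Group G) (_ : Finite G) (p : A → G),
      ∀ E : Finset (G × Q), E.card ≤ m →
      ∃ σ : G → FreeGroup A, ∀ x ∈ E, ∀ y, Conn step p x y →
        Conn step FreeGroup.of (σ x.1, x.2) (σ y.1, y.2) := by
  have h1 : ∃ (G : Type) (_ : Group G) (_ : Finite G) (p : A → G), L step p m := by
    induction m with
    | zero =>
      obtain ⟨G, i1, i2, p, hp⟩ := base_level (A := A) step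
      exact ⟨Ab A G, inferInstance, inferInstance, Ab.gen p, L_zero p hp⟩
    | succ m ih =>
      obtain ⟨G, i1, i2, p, hp⟩ := ih
      exact ⟨Ab A G, inferInstance, inferInstance, Ab.gen p, L_succ p m hp⟩
  obtain ⟨G, i1, i2, p, hp⟩ := h1
  refine ⟨(FreeGroup.lift p).range, inferInstance, inferInstance,
    fun a => ⟨p a, FreeGroup.of a, by simp⟩, fun E hE => ?_⟩
  obtain ⟨σ, hσ⟩ := hp (E.image (fun x => ((x.1 : G), x.2))) 1 (Subgroup.one_mem _) (by
    intro x hx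
    obtain ⟨y, hy, rfl⟩ := Finset.mem_image.1 hx
    exact y.1.2)
    ((Finset.card_filter_le _ _).trans (Finset.card_image_le.trans hE))
  refine ⟨fun x => σ x, fun x hx y hxy => ?_⟩
  exact hσ _ (Finset.mem_image_of_mem (fun x : (FreeGroup.lift p).range × Q => ((x.1 : G), x.2)) hx)
    _ (Conn.map (FreeGroup.lift p).range.subtype (fun _ => rfl) hxy)

end AshPart


namespace DOPart

section ort
variable {T : Type} [Semigroup T]

/-- the key consequence of membership in `DO` -/
def Ort (T : Type) [Semigroup T] : Prop :=
  ∀ x y : T, IsIdempotentElem (x * y) → IsIdempotentElem (y * x) →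
    (x * y) * (y * x) * (x * y) = x * y

/-- `t` is above `e` in the `J`-order, in two-sided form -/
def Abv (e t : T) : Prop := ∃ u v, u * t * v = e

lemma Abv.trans {e f g : T} (h : Abv e f) (h' : Abv f g) : Abv e g := by
  obtain ⟨u, v, rfl⟩ := h
  obtain ⟨u', v', rfl⟩ := h'
  exact ⟨u * u', v' * v, by simp only [mul_assoc]⟩

lemma Abv.refl {e : T} (he : IsIdempotentElem e) : Abv e e :=
  ⟨e, e, by rw [he.eq, he.eq]⟩

lemma idealGen_mono {x y : T} (h : x ∈ idealGen y) : idealGen x ⊆ idealGen y := by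
  have aux : ∀ (z : T), z ∈ idealGen y → ∀ u, z * u ∈ idealGen y ∧ u * z ∈ idealGen y := by
    intro z hz u
    rcases hz with rfl | ⟨a, rfl⟩ | ⟨a, rfl⟩ | ⟨a, b, rfl⟩
    · exact ⟨Or.inr (Or.inl ⟨u, rfl⟩), Or.inr (Or.inr (Or.inl ⟨u, rfl⟩))⟩
    · exact ⟨Or.inr (Or.inl ⟨a * u, by simp only [mul_assoc]⟩),
        Or.inr (Or.inr (Or.inr ⟨u, a, by simp only [mul_assoc]⟩))⟩
    · exact ⟨Or.inr (Or.inr (Or.inr ⟨a, u, by simp only [mul_assoc]⟩)),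
        Or.inr (Or.inr (Or.inl ⟨u * a, by simp only [mul_assoc]⟩))⟩
    · exact ⟨Or.inr (Or.inr (Or.inr ⟨a, b * u, by simp only [mul_assoc]⟩)),
        Or.inr (Or.inr (Or.inr ⟨u * a, b, by simp only [mul_assoc]⟩))⟩
  intro z hz
  rcases hz with rfl | ⟨a, rfl⟩ | ⟨a, rfl⟩ | ⟨a, b, rfl⟩
  · exact h
  · exact (aux x h a).1
  · exact (aux x h a).2
  · exact (aux _ (aux x h a).2 b).1

lemma Abv.mem {x y : T} (h : Abv x y) : x ∈ idealGen y := by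
  obtain ⟨u, v, rfl⟩ := h
  exact Or.inr (Or.inr (Or.inr ⟨u, v, rfl⟩))

lemma self_mem (x : T) : x ∈ idealGen x := Or.inl rfl

lemma mem_jClass_of {x y : T} (h : Abv x y) (h' : Abv y x) : x ∈ jClass y :=
  Set.Subset.antisymm (idealGen_mono h.mem) (idealGen_mono h'.mem)

lemma abv_of_mem {e t : T} (he : IsIdempotentElem e) (h : e ∈ idealGen t) : Abv e t := by
  rcases h with h | ⟨a, h⟩ | ⟨a, h⟩ | ⟨a, b, h⟩
  · rw [← h]; exact Abv.refl he
  · exact ⟨e, a, by rw [mul_assoc, ← h, he.eq]⟩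
  · exact ⟨a, e, by rw [← h, he.eq]⟩
  · exact ⟨a, b, h.symm⟩

lemma abv_idem_of_mem {e t : T} (he : IsIdempotentElem e) (h : t ∈ idealGen e) : Abv t e := by
  rcases h with h | ⟨a, h⟩ | ⟨a, h⟩ | ⟨a, b, h⟩
  · rw [h]; exact Abv.refl he
  · exact ⟨e, a, by rw [h, he.eq]⟩
  · exact ⟨a, e, by rw [h, mul_assoc, he.eq]⟩
  · exact ⟨a, b, h.symm⟩

lemma ort_of_inDO (hT : InDO T) : Ort T := by
  intro x y hxy hyx
  set E := x * y with hE
  set F := y * x with hF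
  have hFE : Abv F E := ⟨y, x, by
    rw [← hyx.eq, hE, hF]; simp only [mul_assoc]⟩
  have hEF : Abv E F := ⟨x, y, by
    rw [← hxy.eq, hE, hF]; simp only [mul_assoc]⟩
  have hEJ : E ∈ jClass E := rfl
  have hFJ : F ∈ jClass E := mem_jClass_of hFE hEF
  obtain ⟨hcl, B, G, iB, iG, hB, φ, hbij, hmul⟩ := hT E ⟨E, hEJ, hxy⟩
  have hid : ∀ z (hz : z ∈ jClass E), IsIdempotentElem z → (φ ⟨z, hz⟩).2 = 1 := by
    intro z hz hi
    have h1 := hmul z z hz hz (hcl z hz z hz)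
    have h2 : φ ⟨z * z, hcl z hz z hz⟩ = φ ⟨z, hz⟩ := by
      congr 1; exact Subtype.ext hi
    rw [h2] at h1
    have := congrArg Prod.snd h1
    simpa using this
  have h1 := hcl E hEJ F hFJ
  have h2 := hcl _ h1 E hEJ
  have := hbij.1 (a₁ := ⟨E * F * E, h2⟩) (a₂ := ⟨E, hEJ⟩) (by
    rw [hmul _ _ h1 hEJ h2, hmul _ _ hEJ hFJ h1]
    apply Prod.ext
    · exact hB _ _
    · simp [hid E hEJ hxy, hid F hFJ hyx])
  exact congrArg Subtype.val this


lemma norm_uv {e t : T} (he : IsIdempotentElem e) (h : Abv e t) :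
    ∃ u v, u * t * v = e ∧ e * u = u ∧ v * e = v := by
  obtain ⟨u, v, h⟩ := h
  have := he.eq
  exact ⟨e * u, v * e, by grind, by grind, by grind⟩

lemma claim1L (hT : Ort T) {e t : T} (he : IsIdempotentElem e) (h : Abv e t) :
    ∃ w, e * t * w = e := by
  obtain ⟨u, v, h, h1, h2⟩ := norm_uv he h
  have h3 : u * (t * v) = e := by grind
  have h4 := hT u (t * v) (by rw [h3]; exact he) (by unfold IsIdempotentElem; grind)
  exact ⟨v * u * e, by grind⟩

lemma claim1R (hT : Ort T) {e t : T} (he : IsIdempotentElem e) (h : Abv e t) :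
    ∃ w, w * t * e = e := by
  obtain ⟨u, v, h, h1, h2⟩ := norm_uv he h
  have h4 := hT (u * t) v (by rw [h]; exact he) (by unfold IsIdempotentElem; grind)
  exact ⟨e * v * u, by grind⟩

/-- right factor of `e t` -/
lemma claimL (hT : Ort T) {e t : T} (he : IsIdempotentElem e) (h : Abv e t) :
    ∃ w g, e * t * w = e ∧ w * (e * t) = g ∧ IsIdempotentElem g ∧ e * t * g = e * t ∧
      Abv e g ∧ Abv g e := by
  obtain ⟨w, h⟩ := claim1L hT he h
  have := he.eq
  refine ⟨w, w * (e * t), h, rfl, by unfold IsIdempotentElem; grind, by grind, ?_, ?_⟩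
  · exact ⟨e * t, w, by grind⟩
  · exact ⟨w, t, by grind⟩

lemma claimR (hT : Ort T) {e t : T} (he : IsIdempotentElem e) (h : Abv e t) :
    ∃ w g, w * t * e = e ∧ (t * e) * w = g ∧ IsIdempotentElem g ∧ g * t * e = t * e ∧
      Abv e g ∧ Abv g e := by
  obtain ⟨w, h⟩ := claim1R hT he h
  have := he.eq
  refine ⟨w, (t * e) * w, h, rfl, by unfold IsIdempotentElem; grind, by grind, ?_, ?_⟩
  · exact ⟨w, t * e, by grind⟩
  · exact ⟨t, w, by grind⟩

lemma Abv.mul (hT : Ort T) {e t t' : T} (he : IsIdempotentElem e) (h : Abv e t) (h' : Abv e t') :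
    Abv e (t * t') := by
  obtain ⟨w, g, h1, h2, h3, h4, h5, h6⟩ := claimL hT he h
  obtain ⟨z, hz⟩ := claim1L hT h3 (h6.trans h')
  have := he.eq
  exact ⟨e, z * w, by grind⟩

lemma R0 (hT : Ort T) {e f : T} (he : IsIdempotentElem e) (hf : IsIdempotentElem f)
    (h : Abv e f) (h' : Abv f e) : e * f * e = e := by
  obtain ⟨u, v, h, h1, h2⟩ := norm_uv he h
  have h3 := he.eq
  have h4 := hf.eq
  have hf' : IsIdempotentElem (f * v * u * f) := by unfold IsIdempotentElem; grind
  have h5 : Abv e (f * v * u * f) := ⟨u, v, by grind⟩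
  obtain ⟨w, hw⟩ := claim1L hT hf (h'.trans h5)
  have h6 : f * v * u * f = f := by grind
  have h7 := hT (u * f) (f * v) (by
    rw [show u * f * (f * v) = e by grind]; exact he) (by
    rw [show f * v * (u * f) = f by grind]; exact hf)
  grind

lemma band_idem (hT : Ort T) {e f : T} (he : IsIdempotentElem e) (hf : IsIdempotentElem f)
    (h : Abv e f) (h' : Abv f e) : IsIdempotentElem (e * f) := by
  have := R0 hT he hf h h'
  unfold IsIdempotentElem; grind

lemma band3 (hT : Ort T) {e f g : T} (he : IsIdempotentElem e) (hf : IsIdempotentElem f)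
    (hg : IsIdempotentElem g) (h1 : Abv e f) (h2 : Abv f e) (h3 : Abv e g) (h4 : Abv g e) :
    e * f * g = e * g := by
  have a1 := R0 hT hg he h4 h3
  have a2 := R0 hT hf hg (h2.trans h3) (h4.trans h1)
  have a3 := hf.eq
  have a4 := band_idem hT hf hg (h2.trans h3) (h4.trans h1)
  have a5 := R0 hT he a4 (h1.trans ⟨f, f, by grind⟩)
    (Abv.trans ⟨f, g, by grind⟩ h2)
  grind

/-- multiplicativity of `t ↦ e t e` -/
lemma emap (hT : Ort T) {e t t' : T} (he : IsIdempotentElem e) (h : Abv e t) (h' : Abv e t') :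
    e * (t * t') * e = (e * t * e) * (e * t' * e) := by
  obtain ⟨w, g, h1, h2, h3, h4, h5, h6⟩ := claimL hT he h
  obtain ⟨w', g', h1', h2', h3', h4', h5', h6'⟩ := claimR hT he h'
  have := band3 hT h3 he h3' h6 h5 (h6.trans h5') (h6'.trans h5)
  have := he.eq
  grind

lemma emap_r (hT : Ort T) {e e' t : T} (he : IsIdempotentElem e) (he' : IsIdempotentElem e')
    (h : Abv e t) (h1 : Abv e e') (h2 : Abv e' e) : e * t * e' = (e * t * e) * e' := by
  obtain ⟨w, g, h1, h2, h3, h4, h5, h6⟩ := claimL hT he h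
  have := band3 hT h3 he he' h6 h5 (h6.trans ‹Abv e e'›) (Abv.trans ‹Abv e' e› h5)
  grind

/-- membership in the maximal subgroup at `e` -/
def InH (e x : T) : Prop := e * x = x ∧ x * e = x ∧ ∃ y, e * y = y ∧ y * e = y ∧ x * y = e ∧ y * x = e

/-- the maximal subgroup at `e` -/
def Hgrp (e : T) : Type := {x : T // InH e x}

/-- group structure of the maximal subgroup -/
@[reducible] noncomputable def hgrp (e : T) (he : IsIdempotentElem e) : Group (Hgrp e) where
  mul x y := ⟨x.1 * y.1, by
    obtain ⟨x, h1, h2, x', h3, h4, h5, h6⟩ := x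
    obtain ⟨y, g1, g2, y', g3, g4, g5, g6⟩ := y
    exact ⟨by grind, by grind, y' * x', by grind, by grind, by grind, by grind⟩⟩
  mul_assoc x y z := Subtype.ext (mul_assoc _ _ _)
  one := ⟨e, he, he, e, he, he, he, he⟩
  one_mul x := Subtype.ext x.2.1
  mul_one x := Subtype.ext x.2.2.1
  inv x := ⟨x.2.2.2.choose, by
    obtain ⟨h1, h2, h3, h4⟩ := x.2.2.2.choose_spec
    exact ⟨h1, h2, x.1, x.2.1, x.2.2.1, h4, h3⟩⟩
  inv_mul_cancel x := Subtype.ext x.2.2.2.choose_spec.2.2.2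

lemma inH_emap (hT : Ort T) {e t : T} (he : IsIdempotentElem e) (h : Abv e t) :
    InH e (e * t * e) := by
  have h0 := he.eq
  obtain ⟨w, hw⟩ := claim1L hT he h
  obtain ⟨w', hw'⟩ := claim1R hT he h
  have a1 := emap hT he h (t' := w) ⟨e * t, e, by grind⟩
  have a2 := emap hT he (t := w') ⟨e, t * e, by grind⟩ h
  have a3 : e * w * e = e * w' * e := by grind
  exact ⟨by grind, by grind, e * w * e, by grind, by grind, by grind, by grind⟩

end ort
end DOPart


namespace DOPart
open Classical

section inDO
variable {T : Type} [Semigroup T]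

lemma fix_exists (hT : Ort T) {e x : T} (he : IsIdempotentElem e) (h : Abv e x) (h' : Abv x e) :
    ∃ f, IsIdempotentElem f ∧ Abv e f ∧ Abv f e ∧ f * x = x ∧ x * f = x := by
  obtain ⟨u, v, rfl⟩ := h'
  have hu : Abv e u := by
    obtain ⟨p, q, h⟩ := h
    exact ⟨p, e * v * q, by grind⟩
  have hv : Abv e v := by
    obtain ⟨p, q, h⟩ := h
    exact ⟨p * u * e, q, by grind⟩
  obtain ⟨w, g, h1, h2, h3, h4, h5, h6⟩ := claimL hT he hv
  obtain ⟨w', g', h1', h2', h3', h4', h5', h6'⟩ := claimR hT he hu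
  have b1 := R0 hT h3 h3' (h6.trans h5') (h6'.trans h5)
  have b2 := R0 hT h3' h3 (h6'.trans h5) (h6.trans h5')
  have b3 := h3.eq
  have b4 := h3'.eq
  refine ⟨g' * g, band_idem hT h3' h3 (h6'.trans h5) (h6.trans h5'), Abv.mul hT he h5' h5,
    Abv.trans (f := g') ⟨g', g, by grind⟩ h6', by grind, by grind⟩

lemma fix_unique (hT : Ort T) {f f' x : T} (hf : IsIdempotentElem f)
    (hf' : IsIdempotentElem f') (h : Abv f x) (h' : Abv f' x) (h1 : f * x = x) (h2 : x * f = x)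
    (h3 : f' * x = x) (h4 : x * f' = x) : f = f' := by
  obtain ⟨w, hw⟩ := claim1L hT hf h
  obtain ⟨w', hw'⟩ := claim1L hT hf' h'
  obtain ⟨z, hz⟩ := claim1R hT hf h
  have a2 : f * f' = f' := by grind
  have a3 : f * f' = f := by
    have h5 : z * x = f := by rw [mul_assoc, h2] at hz; exact hz
    rw [← h5, mul_assoc, h4]
  exact a3.symm.trans a2

/-- the idempotents of the `J`-class of `e` -/
def JE (e : T) : Type := {f : T // IsIdempotentElem f ∧ Abv e f ∧ Abv f e}

/-- semigroup structure on the idempotents of a `J`-class -/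
@[reducible] def jeSemi (hT : Ort T) (e : T) (he : IsIdempotentElem e) : Semigroup (JE e) where
  mul f g := ⟨f.1 * g.1, band_idem hT f.2.1 g.2.1 (f.2.2.2.trans g.2.2.1) (g.2.2.2.trans f.2.2.1),
    Abv.mul hT he f.2.2.1 g.2.2.1,
    Abv.trans (f := f.1) ⟨f.1, g.1, by rw [f.2.1.eq]⟩ f.2.2.2⟩
  mul_assoc f g h := Subtype.ext (mul_assoc _ _ _)

lemma inDO_of_ort (hT : Ort T) : InDO T := by
  rintro s ⟨e, hes, he⟩
  have hJ : jClass s = jClass e := by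
    have : idealGen e = idealGen s := hes
    simp only [jClass, this]
  rw [hJ]
  have memJ : ∀ x, x ∈ jClass e → Abv e x ∧ Abv x e := by
    intro x hx
    have hx : idealGen x = idealGen e := hx
    exact ⟨abv_of_mem he (hx ▸ self_mem e), abv_idem_of_mem he (hx ▸ self_mem x)⟩
  have ofJ : ∀ x, Abv e x → Abv x e → x ∈ jClass e := fun x h h' => mem_jClass_of h' h
  refine ⟨?_, JE e, Hgrp e, jeSemi hT e he, hgrp e he, ?_, ?_⟩
  · intro x hx y hy
    obtain ⟨h1, h2⟩ := memJ x hx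
    obtain ⟨h3, h4⟩ := memJ y hy
    refine ofJ _ (Abv.mul hT he h1 h3) ?_
    obtain ⟨u, v, h2⟩ := h2
    exact ⟨u, v * y, by grind⟩
  · intro f g
    exact Subtype.ext (R0 hT f.2.1 g.2.1 (f.2.2.2.trans g.2.2.1) (g.2.2.2.trans f.2.2.1))
  · have hfix : ∀ x : ↥(jClass e), ∃ f : JE e, f.1 * x.1 = x.1 ∧ x.1 * f.1 = x.1 := by
      intro x
      obtain ⟨h1, h2⟩ := memJ x.1 x.2
      obtain ⟨f, h3, h4, h5, h6, h7⟩ := fix_exists hT he h1 h2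
      exact ⟨⟨f, h3, h4, h5⟩, h6, h7⟩
    choose F hF using hfix
    have hFu : ∀ (x : ↥(jClass e)) (f : JE e), f.1 * x.1 = x.1 → x.1 * f.1 = x.1 → F x = f := by
      intro x f h1 h2
      obtain ⟨h3, h4⟩ := memJ x.1 x.2
      exact Subtype.ext (fix_unique hT (F x).2.1 f.2.1 ((F x).2.2.2.trans h3) (f.2.2.2.trans h3)
        (hF x).1 (hF x).2 h1 h2)
    refine ⟨fun x => (F x, ⟨e * x.1 * e, inH_emap hT he (memJ x.1 x.2).1⟩), ⟨?_, ?_⟩, ?_⟩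
    · rintro x y hxy
      have h1 : F x = F y := congrArg Prod.fst hxy
      have h2 : e * x.1 * e = e * y.1 * e := congrArg Subtype.val (congrArg Prod.snd hxy)
      have key : ∀ z : ↥(jClass e), z.1 = (F z).1 * (e * z.1 * e) * (F z).1 := by
        intro z
        obtain ⟨h3, h4⟩ := memJ z.1 z.2
        have f1 := (F z).2.1
        have f2 := (F z).2.2.1
        have f3 := (F z).2.2.2
        have a1 := emap hT f1 (Abv.mul hT f1 f3 (f3.trans h3)) f3
        have a2 := emap hT f1 f3 (f3.trans h3)
        have a3 := R0 hT f1 he f3 f2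
        have a4 := hF z
        have a5 := f1.eq
        rw [a1, a2, a3]
        grind
      apply Subtype.ext
      rw [key x, key y, h1, h2]
    · rintro ⟨f, g, g1, g2, y, g3, g4, g5, g6⟩
      have f1 := f.2.1
      have f2 := f.2.2.1
      have f3 := f.2.2.2
      have hg : Abv e g := ⟨e, y, by grind⟩
      have hg' : Abv g e := ⟨e, g, by rw [he.eq, g1]⟩
      have hx : f.1 * g * f.1 ∈ jClass e := by
        apply ofJ
        · exact Abv.mul hT he (Abv.mul hT he f2 hg) f2
        · exact Abv.trans ⟨f.1, f.1, rfl⟩ hg'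
      refine ⟨⟨f.1 * g * f.1, hx⟩, ?_⟩
      have a1 := emap hT he (Abv.mul hT he f2 hg) f2
      have a2 := emap hT he f2 hg
      have a3 := R0 hT he f1 f2 f3
      have a5 := f1.eq
      apply Prod.ext
      · apply hFu
        · grind
        · grind
      · apply Subtype.ext
        change e * (f.1 * g * f.1) * e = g
        rw [a1, a2, a3]
        grind
    · intro x y hx hy hxy
      apply Prod.ext
      · change F _ = _
        have h1 := hF ⟨x, hx⟩
        have h2 := hF ⟨y, hy⟩
        set f := F ⟨x, hx⟩
        set g := F ⟨y, hy⟩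
        have b1 := R0 hT f.2.1 g.2.1 (f.2.2.2.trans g.2.2.1) (g.2.2.2.trans f.2.2.1)
        have b2 := R0 hT g.2.1 f.2.1 (g.2.2.2.trans f.2.2.1) (f.2.2.2.trans g.2.2.1)
        apply hFu
        · change f.1 * g.1 * (x * y) = x * y
          grind
        · change (x * y) * (f.1 * g.1) = x * y
          grind
      · apply Subtype.ext
        exact emap hT he (memJ x hx).1 (memJ y hy).1

end inDO

section pow
variable {T : Type} [Semigroup T]

lemma spow_zero (s : T) : spow s 0 = s := rfl
lemma spow_succ (s : T) (n : ℕ) : spow s (n + 1) = spow s n * s := by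
  simp only [spow, Function.iterate_succ_apply']
lemma spow_add (s : T) (m n : ℕ) : spow s m * spow s n = spow s (m + n + 1) := by
  induction n with
  | zero => rw [spow_zero, ← spow_succ]
  | succ n ih => rw [spow_succ, ← mul_assoc, ih, ← spow_succ]; rfl

lemma exists_om1 [Finite T] (s : T) : ∃ g e : T, IsIdempotentElem e ∧ (∃ n, spow s n = e) ∧
    (∃ n, spow s n = g) ∧ g * s = e ∧ s * g = e ∧ g * e = g := by
  obtain ⟨i, j, hij, h⟩ := Finite.exists_ne_map_eq_of_infinite (spow s)
  wlog hlt : i < j generalizing i j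
  · exact this j i hij.symm h.symm (by omega)
  obtain ⟨p, hp⟩ := Nat.exists_eq_add_of_lt hlt
  have per : ∀ k, i ≤ k → spow s (k + (p + 1)) = spow s k := by
    intro k hk
    induction k, hk using Nat.le_induction with
    | base => rw [h, hp]; rfl
    | succ k hk ih =>
      rw [show k + 1 + (p + 1) = (k + (p + 1)) + 1 by omega, spow_succ, ih, ← spow_succ]
  have per2 : ∀ r k, i ≤ k → spow s (k + r * (p + 1)) = spow s k := by
    intro r
    induction r with
    | zero => intro k hk; simp
    | succ r ih =>
      intro k hk
      rw [show k + (r + 1) * (p + 1) = (k + r * (p + 1)) + (p + 1) by ring, per _ (by omega), ih k hk]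
  -- exponent `N + 1 = (i+1)(p+1)`
  obtain ⟨N, hN⟩ : ∃ N, (i + 1) * (p + 1) = N + 1 := ⟨(i + 1) * (p + 1) - 1, by
    have : 0 < (i + 1) * (p + 1) := by positivity
    omega⟩
  have hNi : i ≤ N := by nlinarith
  have hper : ∀ k, i ≤ k → spow s (k + (N + 1)) = spow s k := by
    intro k hk; rw [← hN]; exact per2 _ k hk
  refine ⟨spow s (N + N), spow s N, ?_, ⟨_, rfl⟩, ⟨_, rfl⟩, ?_, ?_, ?_⟩
  · unfold IsIdempotentElem; rw [spow_add]; exact hper N hNi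
  · rw [← spow_succ]; exact hper N hNi
  · have h0 := spow_add s 0 (N + N)
    rw [spow_zero, show 0 + (N + N) + 1 = N + (N + 1) by omega] at h0
    rw [h0]; exact hper N hNi
  · rw [spow_add]; exact hper (N + N) (by omega)

/-- the `ω-1` power -/
noncomputable def om1 [Finite T] (s : T) : T := (exists_om1 s).choose

lemma om1_spec [Finite T] (s : T) : ∃ e : T, IsIdempotentElem e ∧ (∃ n, spow s n = e) ∧
    (∃ n, spow s n = om1 s) ∧ om1 s * s = e ∧ s * om1 s = e ∧ om1 s * e = om1 s :=
  (exists_om1 s).choose_spec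

/-- evaluation of terms -/
noncomputable def ev {A : Type} [Finite T] (f : A → T) : KTerm A → T
  | KTerm.letter a => f a
  | KTerm.mul u v => ev f u * ev f v
  | KTerm.ommPow u => om1 (ev f u)

lemma keval_ev {A : Type} [Finite T] (f : A → T) (t : KTerm A) : KEval f t (ev f t) := by
  induction t with
  | letter a => exact KEval.letter a
  | mul u v hu hv => exact KEval.mul hu hv
  | ommPow u hu =>
    obtain ⟨e, h1, h2, h3, h4, h5, h6⟩ := om1_spec (ev f u)
    exact KEval.ommPow hu h1 h2 h3 h4 h5 h6

/-- value in the free group -/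
def val {A : Type} : KTerm A → FreeGroup A
  | KTerm.letter a => FreeGroup.of a
  | KTerm.mul u v => val u * val v
  | KTerm.ommPow u => (val u)⁻¹

/-- content -/
def cont {A : Type} : KTerm A → Set A
  | KTerm.letter a => {a}
  | KTerm.mul u v => cont u ∪ cont v
  | KTerm.ommPow u => cont u

/-- the idempotent power -/
def omg {A : Type} (t : KTerm A) : KTerm A := KTerm.mul t (KTerm.ommPow t)

@[simp] lemma val_omg {A : Type} (t : KTerm A) : val (omg t) = 1 := by simp [omg, val]
@[simp] lemma cont_omg {A : Type} (t : KTerm A) : cont (omg t) = cont t := by simp [omg, cont]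
lemma idem_omg {A : Type} [Finite T] (f : A → T) (t : KTerm A) :
    IsIdempotentElem (ev f (omg t)) ∧ ∃ n, spow (ev f t) n = ev f (omg t) := by
  obtain ⟨e, h1, h2, h3, h4, h5, h6⟩ := om1_spec (ev f t)
  simp only [omg, ev]
  rw [h5]; exact ⟨h1, h2⟩

lemma Abv.spow (hT : Ort T) {e t : T} (he : IsIdempotentElem e) (h : Abv e t) (n : ℕ) :
    Abv e (spow t n) := by
  induction n with
  | zero => exact h
  | succ n ih => rw [spow_succ]; exact Abv.mul hT he ih h

/-- the assignment into the maximal subgroup -/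
noncomputable def gam {A : Type} (hT : Ort T) {e : T} (he : IsIdempotentElem e) (f : A → T) :
    letI := hgrp e he
    FreeGroup A →* Hgrp e :=
  letI := hgrp e he
  FreeGroup.lift (fun a => if h : Abv e (f a) then ⟨e * f a * e, inH_emap hT he h⟩ else 1)

lemma ev_abv {A : Type} [Finite T] (hT : Ort T) {e : T} (he : IsIdempotentElem e) (f : A → T)
    (t : KTerm A) (h : ∀ b ∈ cont t, Abv e (f b)) : Abv e (ev f t) := by
  induction t with
  | letter a => exact h a rfl
  | mul u v hu hv =>
    exact Abv.mul hT he (hu fun b hb => h b (Or.inl hb)) (hv fun b hb => h b (Or.inr hb))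
  | ommPow u hu =>
    obtain ⟨e', h1, h2, ⟨n, h3⟩, h4, h5, h6⟩ := om1_spec (ev f u)
    change Abv e (om1 (ev f u))
    rw [← h3]
    exact Abv.spow hT he (hu h) n

lemma ev_gam {A : Type} [Finite T] (hT : Ort T) {e : T} (he : IsIdempotentElem e) (f : A → T)
    (t : KTerm A) (h : ∀ b ∈ cont t, Abv e (f b)) :
    e * ev f t * e = (gam hT he f (val t)).1 := by
  let _ := hgrp e he
  induction t with
  | letter a =>
    have := h a rfl
    simp [gam, val, this, ev]
  | mul u v hu hv =>
    have hu := hu fun b hb => h b (Or.inl hb)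
    have hv := hv fun b hb => h b (Or.inr hb)
    have h1 := ev_abv hT he f u fun b hb => h b (Or.inl hb)
    have h2 := ev_abv hT he f v fun b hb => h b (Or.inr hb)
    change e * (ev f u * ev f v) * e = (gam hT he f (val u * val v)).1
    rw [emap hT he h1 h2, map_mul, hu, hv]
    rfl
  | ommPow u hu =>
    have hu := hu h
    have h1 := ev_abv hT he f u h
    obtain ⟨e', h2, ⟨k, h3⟩, ⟨n, h4⟩, h5, h6, h7⟩ := om1_spec (ev f u)
    have h8 : Abv e e' := by rw [← h3]; exact Abv.spow hT he h1 k
    have h9 : Abv e (om1 (ev f u)) := by rw [← h4]; exact Abv.spow hT he h1 n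
    change e * om1 (ev f u) * e = (gam hT he f (val u)⁻¹).1
    have a1 := emap hT he h9 h1
    have a2 := emap hT he h8 h8
    rw [h5] at a1
    rw [h2.eq] at a2
    let X : Hgrp e := ⟨e * e' * e, inH_emap hT he h8⟩
    let Y : Hgrp e := ⟨e * om1 (ev f u) * e, inH_emap hT he h9⟩
    have b2 : X = X * X := Subtype.ext a2
    have b1 : X = Y * gam hT he f (val u) := Subtype.ext (by
      change _ = _ * (gam hT he f (val u)).1
      rw [← hu]; exact a1)
    have b3 : X = 1 := by simpa using b2
    rw [b3] at b1
    rw [map_inv, ← eq_inv_of_mul_eq_one_left b1.symm]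

lemma Abv.left {e u v : T} (h : Abv e (u * v)) : Abv e u := by
  obtain ⟨p, q, h⟩ := h
  exact ⟨p, v * q, by grind⟩

lemma Abv.right {e u v : T} (h : Abv e (u * v)) : Abv e v := by
  obtain ⟨p, q, h⟩ := h
  exact ⟨p * u, q, by grind⟩

lemma Abv.of_spow {e t : T} {n : ℕ} (h : Abv e (_root_.spow t n)) : Abv e t := by
  cases n with
  | zero => exact h
  | succ n =>
    rw [spow_succ] at h
    exact h.right

lemma abv_letter {A : Type} [Finite T] {e : T} (f : A → T) (t : KTerm A) :
    ∀ b ∈ cont t, Abv e (ev f t) → Abv e (f b) := by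
  induction t with
  | letter a => rintro b rfl h; exact h
  | mul u v hu hv =>
    rintro b (hb | hb) h
    · exact hu b hb (Abv.left h)
    · exact hv b hb (Abv.right h)
  | ommPow u hu =>
    intro b hb h
    obtain ⟨e', h1, h2, ⟨n, h3⟩, h4, h5, h6⟩ := om1_spec (ev f u)
    change Abv e (om1 (ev f u)) at h
    rw [← h3] at h
    exact hu b hb (Abv.of_spow h)

/-- the shape of terms of regular elements -/
def regT {A : Type} (x y m y' x' : KTerm A) : KTerm A :=
  KTerm.mul x (KTerm.mul (omg y) (KTerm.mul m (KTerm.mul (omg y') x')))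

lemma omg_abv_letter {A : Type} [Finite T] (f : A → T) (y : KTerm A) :
    ∀ b ∈ cont y, Abv (ev f (omg y)) (f b) := by
  intro b hb
  exact abv_letter f (omg y) b (by simpa using hb) (Abv.refl (idem_omg f y).1)

lemma reg_indep {A : Type} [Finite T] (hT : Ort T) (f : A → T) {x y m y' x' m2 : KTerm A}
    (h1 : cont y = cont y') (h2 : cont m ⊆ cont y) (h3 : cont m2 ⊆ cont y) (hv : val m = val m2) :
    ev f (regT x y m y' x') = ev f (regT x y m2 y' x') := by
  have he := (idem_omg f y).1
  have he' := (idem_omg f y').1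
  have hl := omg_abv_letter f y
  have hl' := omg_abv_letter f y'
  have e1 : Abv (ev f (omg y)) (ev f (omg y')) :=
    ev_abv hT he f (omg y') (by rw [cont_omg, ← h1]; exact hl)
  have e2 : Abv (ev f (omg y')) (ev f (omg y)) :=
    ev_abv hT he' f (omg y) (by rw [cont_omg, h1]; exact hl')
  have a1 := emap_r hT he he' (ev_abv hT he f m fun b hb => hl b (h2 hb)) e1 e2
  have a2 := emap_r hT he he' (ev_abv hT he f m2 fun b hb => hl b (h3 hb)) e1 e2
  have b1 := ev_gam hT he f m fun b hb => hl b (h2 hb)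
  have b2 := ev_gam hT he f m2 fun b hb => hl b (h3 hb)
  rw [hv, ← b2] at b1
  simp only [regT, ev]
  generalize ev f (omg y) = e at *
  generalize ev f (omg y') = e' at *
  grind

lemma reg_idem {A : Type} [Finite T] (hT : Ort T) (f : A → T) {x y m y' x' : KTerm A}
    (h1 : cont y = cont y') (h2 : cont m ⊆ cont y) (h3 : cont x ⊆ cont y) (h4 : cont x' ⊆ cont y)
    (hv : val x * val m * val x' = 1) : IsIdempotentElem (ev f (regT x y m y' x')) := by
  have key := reg_indep hT f (x := x) (y := y) (m := m) (y' := y') (x' := x')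
    (m2 := KTerm.mul m (KTerm.mul (omg y') (KTerm.mul x' (KTerm.mul x (KTerm.mul (omg y) m)))))
    h1 h2 (by simp only [cont, cont_omg, ← h1]; simp [h2, h3, h4]) (by
      simp only [val, val_omg, one_mul]
      have : val m = (val x)⁻¹ * (val x')⁻¹ := by
        rw [← eq_inv_of_mul_eq_one_left hv, inv_mul_cancel_left]
      rw [this]; group)
  unfold IsIdempotentElem
  conv_rhs => rw [key]
  simp only [regT, ev, mul_assoc]

end pow
end DOPart


namespace DOPart
open Classical

/-- product of the letters of a word -/
def wp {A M : Type} [Monoid M] (f : A → M) (w : List A) : M := (w.map f).prod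

section wp
variable {A M : Type} [Monoid M] (f : A → M)
@[simp] lemma wp_nil : wp f [] = 1 := rfl
@[simp] lemma wp_cons (a : A) (w : List A) : wp f (a :: w) = f a * wp f w := by simp [wp]
@[simp] lemma wp_append (u v : List A) : wp f (u ++ v) = wp f u * wp f v := by simp [wp]
end wp

/-- the sharp expansion of a monoid -/
@[ext] structure Sh (A M : Type) where
  t : M
  g : A → Option (M × M)
  d : A → Option (M × M)

variable {A M : Type} [Monoid M]

/-- combination of first-occurrence data -/
def gcomb (s t : M) : Option (M × M) → Option (M × M) → Option (M × M)
  | some (p, q), _ => some (p, q * t)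
  | none, some (p, q) => some (s * p, q)
  | none, none => none

/-- combination of last-occurrence data -/
def dcomb (s t : M) : Option (M × M) → Option (M × M) → Option (M × M)
  | _, some (p, q) => some (s * p, q)
  | some (p, q), none => some (p, q * t)
  | none, none => none

instance : Monoid (Sh A M) where
  mul x y := ⟨x.t * y.t, fun a => gcomb x.t y.t (x.g a) (y.g a), fun a => dcomb x.t y.t (x.d a) (y.d a)⟩
  one := ⟨1, fun _ => none, fun _ => none⟩
  mul_assoc x y z := by
    apply Sh.ext
    · exact mul_assoc _ _ _
    · funext a
      change gcomb (x.t * y.t) z.t (gcomb x.t y.t (x.g a) (y.g a)) (z.g a) =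
        gcomb x.t (y.t * z.t) (x.g a) (gcomb y.t z.t (y.g a) (z.g a))
      rcases x.g a with _ | ⟨p, q⟩ <;> rcases y.g a with _ | ⟨p', q'⟩ <;>
        rcases z.g a with _ | ⟨p'', q''⟩ <;> simp [gcomb, mul_assoc]
    · funext a
      change dcomb (x.t * y.t) z.t (dcomb x.t y.t (x.d a) (y.d a)) (z.d a) =
        dcomb x.t (y.t * z.t) (x.d a) (dcomb y.t z.t (y.d a) (z.d a))
      rcases x.d a with _ | ⟨p, q⟩ <;> rcases y.d a with _ | ⟨p', q'⟩ <;>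
        rcases z.d a with _ | ⟨p'', q''⟩ <;> simp [dcomb, mul_assoc]
  one_mul x := by
    apply Sh.ext
    · exact one_mul _
    · funext a
      change gcomb 1 x.t none (x.g a) = x.g a
      rcases x.g a with _ | ⟨p, q⟩ <;> simp [gcomb]
    · funext a
      change dcomb 1 x.t none (x.d a) = x.d a
      rcases x.d a with _ | ⟨p, q⟩ <;> simp [dcomb]
  mul_one x := by
    apply Sh.ext
    · exact mul_one _
    · funext a
      change gcomb x.t 1 (x.g a) none = x.g a
      rcases x.g a with _ | ⟨p, q⟩ <;> simp [gcomb]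
    · funext a
      change dcomb x.t 1 (x.d a) none = x.d a
      rcases x.d a with _ | ⟨p, q⟩ <;> simp [dcomb]

lemma Sh.mul_t (x y : Sh A M) : (x * y).t = x.t * y.t := rfl
lemma Sh.mul_g (x y : Sh A M) (a : A) : (x * y).g a = gcomb x.t y.t (x.g a) (y.g a) := rfl
lemma Sh.mul_d (x y : Sh A M) (a : A) : (x * y).d a = dcomb x.t y.t (x.d a) (y.d a) := rfl

instance [Finite A] [Finite M] : Finite (Sh A M) :=
  Finite.of_injective (fun x : Sh A M => (x.t, x.g, x.d)) (fun x y h => by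
    simp only [Prod.mk.injEq] at h
    exact Sh.ext h.1 h.2.1 h.2.2)

lemma gcomb_none {s t : M} {x y : Option (M × M)} : gcomb s t x y = none ↔ x = none ∧ y = none := by
  rcases x with _ | ⟨p, q⟩ <;> rcases y with _ | ⟨p', q'⟩ <;> simp [gcomb]
lemma dcomb_none {s t : M} {x y : Option (M × M)} : dcomb s t x y = none ↔ x = none ∧ y = none := by
  rcases x with _ | ⟨p, q⟩ <;> rcases y with _ | ⟨p', q'⟩ <;> simp [dcomb]

lemma sh_ort (hM : Ort M) : Ort (Sh A M) := by
  intro x y hE hF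
  have ht := hM x.t y.t (congrArg Sh.t hE) (congrArg Sh.t hF)
  apply Sh.ext
  · exact ht
  · funext a
    by_cases hn : (x * y).g a = none
    · rw [hn]
      rw [Sh.mul_g, gcomb_none] at hn
      simp only [Sh.mul_g, gcomb_none, hn, and_self]
    · obtain ⟨⟨p, q⟩, hpq⟩ := Option.ne_none_iff_exists'.1 hn
      have h1 := congrArg (fun z => Sh.g z a) hE.eq
      rw [Sh.mul_g, hpq] at h1
      simp only [gcomb, Option.some.injEq, Prod.mk.injEq, true_and] at h1
      rw [Sh.mul_g, Sh.mul_g, hpq]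
      simp only [gcomb, Option.some.injEq, Prod.mk.injEq, true_and]
      simp only [Sh.mul_t] at *
      grind
  · funext a
    by_cases hn : (x * y).d a = none
    · rw [hn]
      rw [Sh.mul_d, dcomb_none] at hn
      simp only [Sh.mul_d, dcomb_none, hn, and_self]
    · obtain ⟨⟨p, q⟩, hpq⟩ := Option.ne_none_iff_exists'.1 hn
      have h1 := congrArg (fun z => Sh.d z a) hE.eq
      rw [Sh.mul_d, hpq] at h1
      simp only [dcomb, Option.some.injEq, Prod.mk.injEq, and_true] at h1
      rw [Sh.mul_d, hpq]
      simp only [dcomb, Option.some.injEq, Prod.mk.injEq, and_true]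
      simp only [Sh.mul_t] at *
      grind

/-- generators of the sharp expansion -/
noncomputable def sgen (f : A → M) (a : A) : Sh A M :=
  ⟨f a, fun b => if b = a then some (1, 1) else none, fun b => if b = a then some (1, 1) else none⟩

lemma wp_t (f : A → M) (w : List A) : (wp (sgen f) w).t = wp f w := by
  induction w with
  | nil => rfl
  | cons a w ih => simp only [wp_cons, Sh.mul_t, ih]; rfl

lemma wp_g_none (f : A → M) (w : List A) (a : A) : (wp (sgen f) w).g a = none ↔ a ∉ w := by
  induction w with
  | nil => simp; rfl
  | cons b w ih => simp [Sh.mul_g, gcomb_none, ih, sgen]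

lemma wp_d_none (f : A → M) (w : List A) (a : A) : (wp (sgen f) w).d a = none ↔ a ∉ w := by
  induction w with
  | nil => simp; rfl
  | cons b w ih => simp [Sh.mul_d, dcomb_none, ih, sgen]

lemma wp_g_some (f : A → M) (u v : List A) (a : A) (h : a ∉ u) :
    (wp (sgen f) (u ++ a :: v)).g a = some (wp f u, wp f v) := by
  have h := (wp_g_none f u a).2 h
  rw [wp_append, wp_cons, Sh.mul_g, h, Sh.mul_g]
  simp [sgen, gcomb, wp_t]

lemma wp_d_some (f : A → M) (u v : List A) (a : A) (h : a ∉ v) :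
    (wp (sgen f) (u ++ a :: v)).d a = some (wp f u, wp f v) := by
  have h := (wp_d_none f v a).2 h
  rw [wp_append, wp_cons, Sh.mul_d, Sh.mul_d, h]
  simp [sgen, dcomb, wp_t]

/-- iterated equivalence by first and last occurrences -/
def Eqv {H : Type} [Monoid H] (h : A → H) : ℕ → List A → List A → Prop
  | 0, u, v => wp h u = wp h v
  | n + 1, u, v => Eqv h n u v ∧ (∀ a, a ∈ u ↔ a ∈ v) ∧
      (∀ a u' u'' v' v'', u = u' ++ a :: u'' → v = v' ++ a :: v'' → a ∉ u' → a ∉ v' →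
        Eqv h n u' v' ∧ Eqv h n u'' v'') ∧
      (∀ a u' u'' v' v'', u = u' ++ a :: u'' → v = v' ++ a :: v'' → a ∉ u'' → a ∉ v'' →
        Eqv h n u' v' ∧ Eqv h n u'' v'')

lemma exists_monoid [Finite A] {H : Type} [Group H] [Finite H] (h : A → H) (n : ℕ) :
    ∃ (M : Type) (_ : Monoid M) (_ : Finite M) (f : A → M), Ort M ∧
      ∀ u v, wp f u = wp f v → Eqv h n u v := by
  induction n with
  | zero =>
    refine ⟨H, inferInstance, inferInstance, h, ?_, fun u v huv => huv⟩
    intro x y h1 h2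
    rw [IsIdempotentElem.iff_eq_one] at h1 h2
    rw [h1, h2]; simp
  | succ n ih =>
    obtain ⟨M, i1, i2, f, hM, hf⟩ := ih
    refine ⟨Sh A M, inferInstance, inferInstance, sgen f, sh_ort hM, fun u v huv => ⟨?_, ?_, ?_, ?_⟩⟩
    · apply hf
      rw [← wp_t, huv, wp_t]
    · intro a
      rw [← not_iff_not, ← wp_g_none f, huv, wp_g_none]
    · rintro a u' u'' v' v'' rfl rfl h1 h2
      have h3 := wp_g_some f u' u'' a h1
      rw [huv, wp_g_some f v' v'' a h2] at h3
      simp only [Option.some.injEq, Prod.mk.injEq] at h3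
      exact ⟨hf _ _ h3.1.symm, hf _ _ h3.2.symm⟩
    · rintro a u' u'' v' v'' rfl rfl h1 h2
      have h3 := wp_d_some f u' u'' a h1
      rw [huv, wp_d_some f v' v'' a h2] at h3
      simp only [Option.some.injEq, Prod.mk.injEq] at h3
      exact ⟨hf _ _ h3.1.symm, hf _ _ h3.2.symm⟩

end DOPart


namespace DOPart
open Classical
open AshPart

section walks
set_option linter.unusedSectionVars false
variable {A S : Type} [Semigroup S] [Finite S] (ψ : A → S)

instance : Finite (WithOne S) := inferInstanceAs (Finite (Option S))

/-- letters in the monoid -/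
def lS (a : A) : WithOne S := (ψ a : WithOne S)

/-- states -/
abbrev St (A S : Type) : Type := WithOne S × Set A

/-- action of words on states -/
def act (X : St A S) (w : List A) : St A S := (X.1 * wp (lS ψ) w, X.2 ∪ {a | a ∈ w})

lemma act_nil (X : St A S) : act ψ X [] = X := by simp [act]
lemma act_append (X : St A S) (u v : List A) : act ψ X (u ++ v) = act ψ (act ψ X u) v := by
  simp only [act, wp_append, mul_assoc, Set.union_assoc]
  congr 2
  ext a; simp
lemma act_cons (X : St A S) (a : A) (v : List A) : act ψ X (a :: v) = act ψ (act ψ X [a]) v :=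
  act_append ψ X [a] v

/-- optional terms -/
noncomputable def oS : Option (KTerm A) → WithOne S
  | none => 1
  | some t => (ev ψ t : S)
/-- content of optional terms -/
def oc : Option (KTerm A) → Set A
  | none => ∅
  | some t => cont t
/-- value of optional terms -/
def oval : Option (KTerm A) → FreeGroup A
  | none => 1
  | some t => val t
/-- product of optional terms -/
def omul : Option (KTerm A) → Option (KTerm A) → Option (KTerm A)
  | none, t => t
  | some t, none => some t
  | some t, some u => some (KTerm.mul t u)

lemma oS_mul (t u : Option (KTerm A)) : oS ψ (omul t u) = oS ψ t * oS ψ u := by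
  rcases t with _ | t <;> rcases u with _ | u <;> simp [omul, oS, ev]
lemma oc_mul (t u : Option (KTerm A)) : oc (omul t u) = oc t ∪ oc u := by
  rcases t with _ | t <;> rcases u with _ | u <;> simp [omul, oc, cont]
lemma oval_mul (t u : Option (KTerm A)) : oval (omul t u) = oval t * oval u := by
  rcases t with _ | t <;> rcases u with _ | u <;> simp [omul, oval, val]

/-- walks labelled by terms -/
def W (X Y : St A S) (g : FreeGroup A) : Prop :=
  ∃ t : Option (KTerm A), X.1 * oS ψ t = Y.1 ∧ X.2 ∪ oc t = Y.2 ∧ oval t = g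

lemma W.refl (X : St A S) : W ψ X X 1 := ⟨none, by simp [oS], by simp [oc], rfl⟩

variable {ψ} in
lemma W.trans {X Y Z : St A S} {g g' : FreeGroup A} (h : W ψ X Y g) (h' : W ψ Y Z g') :
    W ψ X Z (g * g') := by
  obtain ⟨t, h1, h2, rfl⟩ := h
  obtain ⟨t', h1', h2', rfl⟩ := h'
  refine ⟨omul t t', ?_, ?_, oval_mul _ _⟩
  · rw [oS_mul, ← mul_assoc, h1, h1']
  · rw [oc_mul, ← Set.union_assoc, h2, h2']

lemma W.letter (X : St A S) (a : A) : W ψ X (act ψ X [a]) (FreeGroup.of a) :=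
  ⟨some (KTerm.letter a), by simp [oS, act, ev, lS], by
    simp only [oc, act, cont]; congr 1; ext b; simp, rfl⟩

lemma W.word (X : St A S) (w : List A) : ∃ g, W ψ X (act ψ X w) g := by
  induction w generalizing X with
  | nil => exact ⟨1, by rw [act_nil]; exact W.refl ψ X⟩
  | cons a w ih =>
    obtain ⟨g, hg⟩ := ih (act ψ X [a])
    rw [act_cons]
    exact ⟨_, (W.letter ψ X a).trans hg⟩

variable {ψ} in
lemma W.inv {X : St A S} {g : FreeGroup A} (h : W ψ X X g) : W ψ X X g⁻¹ := by
  obtain ⟨t, h1, h2, rfl⟩ := h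
  rcases t with _ | t
  · simpa [oval] using W.refl ψ X
  · refine ⟨some (KTerm.ommPow t), ?_, h2, rfl⟩
    obtain ⟨e, -, -, ⟨n, h3⟩, -⟩ := om1_spec (ev ψ t)
    change X.1 * ((om1 (ev ψ t) : S) : WithOne S) = X.1
    rw [← h3]
    clear h3
    change X.1 * ((ev ψ t : S) : WithOne S) = X.1 at h1
    induction n with
    | zero => exact h1
    | succ n ih => rw [spow_succ, WithOne.coe_mul, ← mul_assoc, ih, h1]

/-- the graph -/
def gstep : (St A S ⊕ (A × Bool)) → A → (St A S ⊕ (A × Bool)) → Prop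
  | Sum.inl X, a, Sum.inl Y => Y = act ψ X [a] ∧ ∃ r, act ψ Y r = X
  | Sum.inr x, a, Sum.inr y => x = (a, false) ∧ y = (a, true)
  | _, _, _ => False

/-- invariant for connectedness over the free group -/
def Good : FreeGroup A × (St A S ⊕ (A × Bool)) → FreeGroup A × (St A S ⊕ (A × Bool)) → Prop
  | (g, Sum.inl X), (g', Sum.inl Y) => W ψ X Y (g⁻¹ * g') ∧ W ψ Y X (g'⁻¹ * g)
  | (g, Sum.inr x), (g', Sum.inr y) => x.1 = y.1 ∧
      (if x.2 then g * (FreeGroup.of x.1)⁻¹ else g) = (if y.2 then g' * (FreeGroup.of y.1)⁻¹ else g')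
  | _, _ => False

lemma conn_good {x y : FreeGroup A × (St A S ⊕ (A × Bool))}
    (h : Conn (gstep ψ) FreeGroup.of x y) : Good ψ x y := by
  induction h with
  | rel x y h =>
    obtain ⟨g, q⟩ := x
    obtain ⟨g', q'⟩ := y
    obtain ⟨a, h1, h2⟩ := h
    simp only at h1 h2
    subst h2
    rcases q with X | x <;> rcases q' with Y | y
    · obtain ⟨rfl, r, hr⟩ := h1
      refine ⟨by simpa using W.letter ψ X a, ?_⟩
      obtain ⟨k, hk⟩ := W.word ψ (act ψ X [a]) r
      rw [hr] at hk
      have := hk.trans ((W.letter ψ X a).trans hk).inv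
      simpa using this
    · exact h1
    · exact h1
    · obtain ⟨rfl, rfl⟩ := h1
      simp [Good]
  | refl x =>
    obtain ⟨g, X | x⟩ := x
    · simp only [Good, inv_mul_cancel]; exact ⟨W.refl ψ X, W.refl ψ X⟩
    · simp [Good]
  | symm x y _ ih =>
    obtain ⟨g, X | x⟩ := x <;> obtain ⟨g', Y | y⟩ := y
    · exact ih.symm
    · exact ih
    · exact ih
    · exact ⟨ih.1.symm, ih.2.symm⟩
  | trans x y z _ _ ih ih' =>
    obtain ⟨g, X | x⟩ := x <;> obtain ⟨g', Y | y⟩ := y <;> obtain ⟨g'', Z | z⟩ := z <;>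
      try first | exact ih.elim | exact ih'.elim
    · have h1 := ih.1.trans ih'.1
      have h2 := ih'.2.trans ih.2
      simp only [mul_assoc, mul_inv_cancel_left] at h1 h2
      exact ⟨h1, h2⟩
    · exact ⟨ih.1.trans ih'.1, ih.2.trans ih'.2⟩

lemma split_scc (X : St A S) (w : List A) : (∃ r, act ψ (act ψ X w) r = X) ∨
    ∃ u a v, w = u ++ a :: v ∧ (∃ r, act ψ (act ψ X u) r = X) ∧
      ¬ ∃ r, act ψ (act ψ X (u ++ [a])) r = X := by
  induction w using List.reverseRecOn with
  | nil => left; exact ⟨[], by simp [act_nil]⟩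
  | append_singleton w b ih =>
    rcases ih with ih | ⟨u, a, v, rfl, h1, h2⟩
    · by_cases h : ∃ r, act ψ (act ψ X (w ++ [b])) r = X
      · exact Or.inl h
      · exact Or.inr ⟨w, b, [], rfl, ih, h⟩
    · exact Or.inr ⟨u, a, v ++ [b], by simp, h1, h2⟩

variable {G : Type} [Group G] (p : A → G)

lemma conn_scc (X : St A S) (w : List A) (h : G) (hr : ∃ r, act ψ (act ψ X w) r = X) :
    Conn (gstep ψ) p (h, Sum.inl X) (h * wp p w, Sum.inl (act ψ X w)) := by
  induction w generalizing X h with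
  | nil => simp only [wp_nil, mul_one, act_nil]; exact Conn.refl _
  | cons a w ih =>
    obtain ⟨r, hr⟩ := hr
    have h1 : gstep ψ (Sum.inl X) a (Sum.inl (act ψ X [a])) :=
      ⟨rfl, w ++ r, by rw [act_append, ← act_cons, hr]⟩
    have h2 := ih (act ψ X [a]) (h * p a) ⟨r ++ [a], by
      rw [act_append, ← act_cons, hr]⟩
    rw [act_cons, wp_cons, ← mul_assoc]
    exact (Conn.edge h1).trans h2

/-- compatibility of a lifting function with a set of pieces -/
def Compat (E : Finset (G × (St A S ⊕ (A × Bool)))) (σ : G → FreeGroup A) : Prop :=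
  ∀ x ∈ E, ∀ y, Conn (gstep ψ) p x y → Conn (gstep ψ) FreeGroup.of (σ x.1, x.2) (σ y.1, y.2)

variable {ψ p} in
lemma Compat.mono {E E' : Finset (G × (St A S ⊕ (A × Bool)))} {σ : G → FreeGroup A}
    (h : Compat ψ p E' σ) (hE : E ⊆ E') : Compat ψ p E σ :=
  fun x hx y hy => h x (hE hx) y hy

lemma runs_aux [Finite A] (n : ℕ) : ∀ (X : St A S) (w : List A) (h : G),
    {Y | ∃ r, act ψ X r = Y}.ncard ≤ n →
    ∃ E : Finset (G × (St A S ⊕ (A × Bool))), E.card ≤ 2 * n ∧ ∀ σ, Compat ψ p E σ →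
      W ψ X (act ψ X w) ((σ h)⁻¹ * σ (h * wp p w)) := by
  induction n with
  | zero =>
    intro X w h hn
    exfalso
    have : X ∈ {Y | ∃ r, act ψ X r = Y} := ⟨[], act_nil ψ X⟩
    rw [Nat.le_zero, Set.ncard_eq_zero] at hn
    rw [hn] at this
    exact this
  | succ n ih =>
    intro X w h hn
    rcases split_scc ψ X w with hr | ⟨u, a, v, rfl, hr, hnr⟩
    · refine ⟨{(h, Sum.inl X)}, by simp; omega, fun σ hσ => ?_⟩
      exact (conn_good ψ (hσ _ (Finset.mem_singleton_self _) _ (conn_scc ψ p X w h hr))).1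
    · obtain ⟨E, hE, hEσ⟩ := ih (act ψ X (u ++ [a])) v (h * wp p u * p a) (by
        have : {Y | ∃ r, act ψ (act ψ X (u ++ [a])) r = Y} ⊂ {Y | ∃ r, act ψ X r = Y} := by
          refine ⟨?_, fun hs => hnr (hs ⟨[], act_nil ψ X⟩)⟩
          rintro Y ⟨r, rfl⟩
          exact ⟨u ++ [a] ++ r, act_append ψ X _ _⟩
        have := Set.ncard_lt_ncard this
        omega)
      refine ⟨insert (h, Sum.inl X) (insert (h * wp p u, Sum.inr (a, false)) E), ?_, fun σ hσ => ?_⟩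
      · have h1 := Finset.card_insert_le (h, Sum.inl X) (insert (h * wp p u, Sum.inr (a, false)) E)
        have h2 := Finset.card_insert_le (h * wp p u, (Sum.inr (a, false) : St A S ⊕ (A × Bool))) E
        omega
      · have h1 := hEσ σ (hσ.mono (fun x hx => by simp [hx]))
        have h2 := (conn_good ψ (hσ (h, Sum.inl X) (by simp) _ (conn_scc ψ p X u h hr))).1
        have h3 := conn_good ψ (hσ (h * wp p u, Sum.inr (a, false)) (by simp)
          (h * wp p u * p a, Sum.inr (a, true)) (Conn.edge ⟨rfl, rfl⟩))
        have h3 : σ (h * wp p u * p a) = σ (h * wp p u) * FreeGroup.of a := by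
          simpa [Good, eq_mul_inv_iff_mul_eq, eq_comm] using h3
        have h4 := (h2.trans (W.letter ψ _ a)).trans ((act_append ψ X u [a]) ▸ h1)
        rw [← act_append, ← act_append] at h4
        simp only [List.append_assoc, List.singleton_append] at h4
        simp only [wp_append, wp_cons]
        rw [h3] at h4
        simpa [mul_assoc] using h4

lemma runs [Finite A] (w : List A) (hw : w ≠ []) (h : G) :
    ∃ E : Finset (G × (St A S ⊕ (A × Bool))), E.card ≤ 2 * Nat.card (St A S) ∧
      ∀ σ, Compat ψ p E σ → ∃ t : KTerm A, wp (lS ψ) w = ((ev ψ t : S) : WithOne S) ∧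
        cont t = {a | a ∈ w} ∧ val t = (σ h)⁻¹ * σ (h * wp p w) := by
  obtain ⟨E, hE, h1⟩ := runs_aux ψ p (Nat.card (St A S)) (1, ∅) w h (Set.ncard_le_card _)
  refine ⟨E, hE, fun σ hσ => ?_⟩
  obtain ⟨t, h2, h3, h4⟩ := h1 σ hσ
  rcases t with _ | t
  · exfalso
    simp only [oc, act, Set.empty_union] at h3
    obtain ⟨a, w, rfl⟩ := List.exists_cons_of_ne_nil hw
    have : a ∈ (∅ : Set A) := by rw [h3]; simp
    exact this
  · simp only [act, one_mul, Set.empty_union] at h2 h3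
    exact ⟨t, h2.symm, h3, h4⟩

end walks
end DOPart


namespace DOPart
open Classical
open AshPart

section plans
set_option linter.unusedSectionVars false
variable {A S : Type} [Semigroup S] [Finite S] {G : Type} [Group G] {I : Type}

/-- plans: simultaneous factorizations of a tuple of words -/
inductive Plan (ψ : A → S) (p : A → G) : Bool → ℕ → (I → List A) → Prop
  | letter (a : A) : Plan ψ p false 1 (fun _ => [a])
  | mul {b b' : Bool} {n n' : ℕ} {u v : I → List A} : Plan ψ p b n u → Plan ψ p b' n' v →
      Plan ψ p false (n + n') (fun i => u i ++ v i)
  | reg {b1 b2 b3 b4 : Bool} {n1 n2 n3 n4 : ℕ} {x y y' x' : I → List A} (m : I → List A) (B : Set A) :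
      Plan ψ p b1 n1 x → Plan ψ p b2 n2 y → Plan ψ p b3 n3 y' → Plan ψ p b4 n4 x' →
      (∀ i, m i ≠ []) → (∀ i j, wp p (m i) = wp p (m j)) →
      (∀ i, {a | a ∈ y i} = B) → (∀ i, {a | a ∈ y' i} = B) →
      (∀ i, {a | a ∈ x i} ⊆ B) → (∀ i, {a | a ∈ x' i} ⊆ B) → (∀ i, {a | a ∈ m i} ⊆ B) →
      (∀ i, wp (lS ψ) (x i) * wp (lS ψ) (y i) = wp (lS ψ) (x i)) →
      (∀ i, wp (lS ψ) (y' i) * wp (lS ψ) (x' i) = wp (lS ψ) (x' i)) →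
      Plan ψ p true (n1 + n2 + n3 + n4 + 1) (fun i => x i ++ (y i ++ (m i ++ (y' i ++ x' i))))

lemma plan_const {ψ : A → S} {p : A → G} {b : Bool} {n : ℕ} {w : I → List A}
    (h : Plan ψ p b n w) : ∀ i j, wp p (w i) = wp p (w j) := by
  induction h with
  | letter a => intro i j; rfl
  | mul _ _ ih1 ih2 =>
    intro i j
    rw [wp_append, wp_append, ih1 i j, ih2 i j]
  | reg m B _ _ _ _ _ hm _ _ _ _ _ _ _ ih1 ih2 ih3 ih4 =>
    intro i j
    simp only [wp_append]
    rw [ih1 i j, ih2 i j, ih3 i j, ih4 i j, hm i j]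

/-- the terms `t` realize the words `w` -/
def Realize (ψ : A → S) (t : I → KTerm A) (w : I → List A) (g : I → FreeGroup A) : Prop :=
  (∀ i, wp (lS ψ) (w i) = ((ev ψ (t i) : S) : WithOne S)) ∧
  (∀ i, cont (t i) = {a | a ∈ w i}) ∧ (∀ i, val (t i) = g i) ∧
  (∀ (T : Type) [Semigroup T] [Finite T], Ort T → ∀ (f : A → T) i j, ev f (t i) = ev f (t j))

/-- liftability -/
def Lift (ψ : A → S) (p : A → G) (c : ℕ) (b : Bool) (n : ℕ) (w : I → List A) : Prop :=
  ∀ h : G, ∃ E : Finset (G × (St A S ⊕ (A × Bool))), E.card ≤ c * n ∧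
    ∀ σ, Compat ψ p E σ → ∃ t : I → KTerm A,
      Realize ψ t w (fun i => (σ h)⁻¹ * σ (h * wp p (w i))) ∧
      (b = true → ∀ i, val (t i) = 1 → ∀ (T : Type) [Semigroup T] [Finite T], Ort T →
        ∀ f : A → T, IsIdempotentElem (ev f (t i)))

lemma fix_spow_r {X : WithOne S} {s : S} (h : X * (s : WithOne S) = X) (n : ℕ) :
    X * ((spow s n : S) : WithOne S) = X := by
  induction n with
  | zero => exact h
  | succ n ih => rw [spow_succ, WithOne.coe_mul, ← mul_assoc, ih, h]

lemma fix_spow_l {X : WithOne S} {s : S} (h : (s : WithOne S) * X = X) (n : ℕ) :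
    ((spow s n : S) : WithOne S) * X = X := by
  induction n with
  | zero => exact h
  | succ n ih => rw [spow_succ, WithOne.coe_mul, mul_assoc, h, ih]

lemma cont_regT (x y m y' x' : KTerm A) :
    cont (regT x y m y' x') = cont x ∪ (cont y ∪ (cont m ∪ (cont y' ∪ cont x'))) := by
  simp [regT, cont]
lemma val_regT (x y m y' x' : KTerm A) :
    val (regT x y m y' x') = val x * val m * val x' := by
  simp [regT, val, mul_assoc]

lemma plan_lift [Finite A] [Finite I] [Nonempty I] {ψ : A → S} {p : A → G} {b : Bool} {n : ℕ}
    {w : I → List A} (hw : Plan ψ p b n w) :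
    Lift ψ p ((Nat.card I + 1) * (2 * Nat.card (St A S))) b n w := by
  set c0 := 2 * Nat.card (St A S) with hc0
  set c := (Nat.card I + 1) * c0 with hc
  induction hw with
  | letter a =>
    intro h
    obtain ⟨E, hE, h1⟩ := runs ψ p [a] (by simp) h
    refine ⟨E, ?_, fun σ hσ => ?_⟩
    · rw [hc]; nlinarith
    · obtain ⟨t, h2, h3, h4⟩ := h1 σ hσ
      exact ⟨fun _ => t, ⟨fun _ => h2, fun _ => h3, fun _ => h4, fun T _ _ _ f i j => rfl⟩,
        fun h => by simp at h⟩
  | @mul b b' n n' u v hu hv ih1 ih2 =>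
    intro h
    let i0 : I := Classical.arbitrary I
    obtain ⟨E1, hE1, h1⟩ := ih1 h
    obtain ⟨E2, hE2, h2⟩ := ih2 (h * wp p (u i0))
    refine ⟨E1 ∪ E2, ?_, fun σ hσ => ?_⟩
    · have := Finset.card_union_le E1 E2
      rw [mul_add]; omega
    · obtain ⟨t1, ⟨a1, a2, a3, a4⟩, -⟩ := h1 σ (hσ.mono Finset.subset_union_left)
      obtain ⟨t2, ⟨b1, b2, b3, b4⟩, -⟩ := h2 σ (hσ.mono Finset.subset_union_right)
      refine ⟨fun i => KTerm.mul (t1 i) (t2 i), ⟨?_, ?_, ?_, ?_⟩, fun h => by simp at h⟩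
      · intro i
        simp only [wp_append, a1 i, b1 i, ev, WithOne.coe_mul]
      · intro i
        simp only [cont, a2 i, b2 i]
        ext a; simp
      · intro i
        simp only [val, a3 i, b3 i, wp_append]
        rw [plan_const hu i0 i]
        simp [mul_assoc]
      · intro T _ _ hT f i j
        simp only [ev]
        rw [a4 T hT f i j, b4 T hT f i j]
  | @reg b1 b2 b3 b4 n1 n2 n3 n4 x y y' x' m B hx hy hy' hx' hm hmc cy cy' cx cx' cm hxy hyx
      ih1 ih2 ih3 ih4 =>
    intro h
    let i0 : I := Classical.arbitrary I
    have := Fintype.ofFinite I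
    set g1 := h * wp p (x i0) with hg1
    set g2 := g1 * wp p (y i0) with hg2
    set g3 := g2 * wp p (m i0) with hg3
    set g4 := g3 * wp p (y' i0) with hg4
    obtain ⟨E1, hE1, h1⟩ := ih1 h
    obtain ⟨E2, hE2, h2⟩ := ih2 g1
    obtain ⟨E3, hE3, h3⟩ := ih3 g3
    obtain ⟨E4, hE4, h4⟩ := ih4 g4
    choose E5 hE5 h5 using fun i => runs ψ p (m i) (hm i) g2
    refine ⟨E1 ∪ (E2 ∪ (E3 ∪ (E4 ∪ Finset.univ.biUnion E5))), ?_, fun σ hσ => ?_⟩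
    · have k1 := Finset.card_union_le E1 (E2 ∪ (E3 ∪ (E4 ∪ Finset.univ.biUnion E5)))
      have k2 := Finset.card_union_le E2 (E3 ∪ (E4 ∪ Finset.univ.biUnion E5))
      have k3 := Finset.card_union_le E3 (E4 ∪ Finset.univ.biUnion E5)
      have k4 := Finset.card_union_le E4 (Finset.univ.biUnion E5)
      have k5 : (Finset.univ.biUnion E5).card ≤ Nat.card I * c0 := by
        rw [Nat.card_eq_fintype_card]
        exact Finset.card_biUnion_le_card_mul _ _ _ (fun i _ => hE5 i)
      have k6 : Nat.card I * c0 ≤ c := by rw [hc]; nlinarith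
      rw [mul_add, mul_add, mul_add, mul_add]
      omega
    · obtain ⟨t1, ⟨a1, a2, a3, a4⟩, -⟩ := h1 σ (hσ.mono (by intro z hz; simp [hz]))
      obtain ⟨t2, ⟨b1, b2, b3, b4⟩, -⟩ := h2 σ (hσ.mono (by intro z hz; simp [hz]))
      obtain ⟨t3, ⟨c1, c2, c3, c4⟩, -⟩ := h3 σ (hσ.mono (by intro z hz; simp [hz]))
      obtain ⟨t4, ⟨d1, d2, d3, d4⟩, -⟩ := h4 σ (hσ.mono (by intro z hz; simp [hz]))
      choose t5 e1 e2 e3 using fun i => h5 i σ (hσ.mono (by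
        intro z hz
        simp only [Finset.mem_union, Finset.mem_biUnion, Finset.mem_univ, true_and]
        exact Or.inr (Or.inr (Or.inr (Or.inr ⟨i, hz⟩)))))
      have C2 : ∀ i, cont (t2 i) = B := fun i => (b2 i).trans (cy i)
      have C3 : ∀ i, cont (t3 i) = B := fun i => (c2 i).trans (cy' i)
      have C1 : ∀ i, cont (t1 i) ⊆ B := fun i => by rw [a2]; exact cx i
      have C4 : ∀ i, cont (t4 i) ⊆ B := fun i => by rw [d2]; exact cx' i
      have C5 : ∀ i, cont (t5 i) ⊆ B := fun i => by rw [e2]; exact cm i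
      let tm : I → KTerm A := fun i => KTerm.mul (t2 i) (KTerm.mul (t5 i) (t3 i))
      have Cm : ∀ i j, cont (tm i) ⊆ cont (t2 j) := by
        intro i j
        simp only [tm, cont, C2, C3]
        simp [C5 i]
      have hval : ∀ i, val (tm i) = (σ g1)⁻¹ * σ g4 := by
        intro i
        simp only [tm, val, b3 i, c3 i, e3 i]
        rw [plan_const hy i i0, plan_const hy' i i0, hmc i i0, ← hg2, ← hg3, ← hg4]
        simp [mul_assoc]
      refine ⟨fun i => regT (t1 i) (t2 i) (tm i) (t3 i) (t4 i), ⟨?_, ?_, ?_, ?_⟩, ?_⟩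
      · intro i
        simp only [wp_append]
        obtain ⟨n, hn⟩ := (idem_omg ψ (t2 i)).2
        obtain ⟨n', hn'⟩ := (idem_omg ψ (t3 i)).2
        have f1 := hxy i
        have f2 := hyx i
        rw [a1 i, b1 i] at f1
        rw [c1 i, d1 i] at f2
        have f3 := fix_spow_r f1 n
        have f4 := fix_spow_l f2 n'
        rw [hn] at f3
        rw [hn'] at f4
        rw [a1 i, b1 i, c1 i, d1 i, e1 i]
        simp only [regT, ev, tm, WithOne.coe_mul]
        rw [f4]
        conv_rhs => rw [← mul_assoc, f3]
        simp only [mul_assoc]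
      · intro i
        rw [cont_regT]
        simp only [tm, cont, a2, b2, c2, d2, e2]
        ext a
        simp only [Set.mem_union, Set.mem_ofPred_eq, List.mem_append]
        grind
      · intro i
        rw [val_regT, a3 i, d3 i, hval i]
        simp only [wp_append]
        rw [plan_const hx i i0, plan_const hy i i0, hmc i i0, plan_const hy' i i0]
        simp [hg1, hg2, hg3, hg4, mul_assoc]
      · intro T _ _ hT f i j
        have := reg_indep hT f (x := t1 j) (y := t2 j) (y' := t3 j) (x' := t4 j) (m := tm i)
          (m2 := tm j) ((C2 j).trans (C3 j).symm) (Cm i j) (Cm j j) ((hval i).trans (hval j).symm)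
        change ev f (regT (t1 i) (t2 i) (tm i) (t3 i) (t4 i)) = _
        rw [← this]
        simp only [regT, omg, ev]
        rw [a4 T hT f i j, b4 T hT f i j, c4 T hT f i j, d4 T hT f i j]
      · intro _ i hi T _ _ hT f
        rw [val_regT] at hi
        exact reg_idem hT f ((C2 i).trans (C3 i).symm) (Cm i i) ((C1 i).trans (C2 i).symm.subset)
          ((C4 i).trans (C2 i).symm.subset) hi

end plans
end DOPart


namespace DOPart
open Classical
open AshPart

section words
variable {A : Type}

lemma last_first (w : List A) (hw : w ≠ []) :
    ∃ u a v, w = u ++ a :: v ∧ a ∉ u ∧ ∀ x ∈ w, x ∈ u ∨ x = a := by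
  induction w using List.reverseRecOn with
  | nil => exact absurd rfl hw
  | append_singleton w c ih =>
    by_cases h : w = []
    · subst h
      exact ⟨[], c, [], by simp⟩
    · obtain ⟨u, a, v, h1, h2, h3⟩ := ih h
      by_cases hc : c ∈ w
      · refine ⟨u, a, v ++ [c], by simp [h1], h2, fun x hx => ?_⟩
        simp only [List.mem_append, List.mem_singleton] at hx
        rcases hx with hx | rfl
        · exact h3 x hx
        · exact h3 _ hc
      · exact ⟨w, c, [], by simp, hc, fun x hx => by simpa using hx⟩

lemma first_last (w : List A) (hw : w ≠ []) :
    ∃ u a v, w = u ++ a :: v ∧ a ∉ v ∧ ∀ x ∈ w, x ∈ v ∨ x = a := by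
  obtain ⟨u, a, v, h1, h2, h3⟩ := last_first w.reverse (by simpa using hw)
  refine ⟨v.reverse, a, u.reverse, ?_, by simpa using h2, fun x hx => ?_⟩
  · rw [← List.reverse_reverse w, h1]; simp
  · simpa using h3 x (by simpa using hx)

lemma first_occ {w : List A} {a : A} (h : a ∈ w) : ∃ u v, w = u ++ a :: v ∧ a ∉ u :=
  List.eq_append_cons_of_mem h

lemma last_occ {w : List A} {a : A} (h : a ∈ w) : ∃ u v, w = u ++ a :: v ∧ a ∉ v := by
  obtain ⟨u, v, h1, h2⟩ := first_occ (w := w.reverse) (a := a) (by simpa using h)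
  refine ⟨v.reverse, u.reverse, ?_, by simpa using h2⟩
  rw [← List.reverse_reverse w, h1]; simp

/-- `w` contains `k` disjoint factors each containing all letters of `B` -/
def HB (B : Finset A) (k : ℕ) (w : List A) : Prop :=
  ∃ (r : List A) (L : List (List A)) (r' : List A), w = r ++ L.flatten ++ r' ∧ L.length = k ∧
    ∀ l ∈ L, ∀ b ∈ B, b ∈ l

lemma HB_zero (B : Finset A) (w : List A) : HB B 0 w := ⟨w, [], [], by simp⟩

lemma HB_mem {B : Finset A} {k : ℕ} {w : List A} (h : HB B (k + 1) w) : ∀ b ∈ B, b ∈ w := by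
  obtain ⟨r, L, r', rfl, h2, h3⟩ := h
  intro b hb
  rcases L with _ | ⟨l, L⟩
  · simp at h2
  · have := h3 l (by simp) b hb
    simp [this]

lemma HB_cons {B : Finset A} {k : ℕ} {z v : List A} (hz : ∀ b ∈ B, b ∈ z) (h : HB B k v) :
    HB B (k + 1) (z ++ v) := by
  obtain ⟨r, L, r', rfl, h2, h3⟩ := h
  refine ⟨[], (z ++ r) :: L, r', by simp, by simp [h2], ?_⟩
  intro l hl b hb
  rcases List.mem_cons.1 hl with rfl | hl
  · simp [hz b hb]
  · exact h3 l hl b hb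

lemma HB_popl {B : Finset A} {k : ℕ} {u v : List A} {a : A} (ha : a ∈ B) (hu : a ∉ u)
    (h : HB B (k + 1) (u ++ a :: v)) : HB B k v := by
  obtain ⟨r, L, r', h1, h2, h3⟩ := h
  rcases L with _ | ⟨l, L⟩
  · simp at h2
  · have hal : a ∈ r ++ l := by simp [h3 l (by simp) a ha]
    have h4 : u ++ a :: v = (r ++ l) ++ (L.flatten ++ r') := by rw [h1]; simp
    rcases List.append_eq_append_iff.1 h4 with ⟨t, e1, e2⟩ | ⟨t, e1, e2⟩
    · rcases t with _ | ⟨c, t⟩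
      · simp at e1
        rw [e1] at hal; exact absurd hal hu
      · simp only [List.cons_append, List.cons.injEq] at e2
        refine ⟨t, L, r', by rw [e2.2]; simp, by simpa using h2, fun l hl => h3 l (by simp [hl])⟩
    · rw [e1] at hu
      exact absurd (List.mem_append_left _ hal) hu

lemma HB_popr {B : Finset A} {k : ℕ} {u v : List A} {a : A} (ha : a ∈ B) (hv : a ∉ v)
    (h : HB B (k + 1) (u ++ a :: v)) : HB B k u := by
  obtain ⟨r, L, r', h1, h2, h3⟩ := h
  rcases List.eq_nil_or_concat L with rfl | ⟨L', l, rfl⟩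
  · simp at h2
  · have hal : a ∈ l ++ r' := by simp [h3 l (by simp) a ha]
    have h4 : u ++ a :: v = (r ++ L'.flatten) ++ (l ++ r') := by rw [h1]; simp
    have hmain : ∃ t, u = (r ++ L'.flatten) ++ t := by
      rcases List.append_eq_append_iff.1 h4 with ⟨t, e1, e2⟩ | ⟨t, e1, e2⟩
      · rcases t with _ | ⟨c, t⟩
        · exact ⟨[], by simpa using e1.symm⟩
        · simp only [List.cons_append, List.cons.injEq] at e2
          rw [e2.2] at hv
          exact absurd (List.mem_append_right _ hal) hv
      · exact ⟨t, e1⟩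
    obtain ⟨t, ht⟩ := hmain
    exact ⟨r, L', t, ht, by simpa using h2, fun l hl => h3 l (by simp [hl])⟩

lemma Eqv_mono {H : Type} [Monoid H] {h : A → H} {m n : ℕ} (hmn : n ≤ m) {u v : List A}
    (e : Eqv h m u v) : Eqv h n u v := by
  induction m with
  | zero => obtain rfl : n = 0 := by omega
            exact e
  | succ m ih =>
    rcases Nat.lt_or_ge m n with h1 | h1
    · obtain rfl : n = m + 1 := by omega
      exact e
    · exact ih h1 e.1

lemma Eqv_wp {H : Type} [Monoid H] {h : A → H} {m : ℕ} {u v : List A}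
    (e : Eqv h m u v) : wp h u = wp h v := Eqv_mono (Nat.zero_le m) e

lemma Eqv_mem {H : Type} [Monoid H] {h : A → H} {m : ℕ} (hm : 1 ≤ m) {u v : List A}
    (e : Eqv h m u v) (a : A) : a ∈ u ↔ a ∈ v := by
  obtain ⟨m, rfl⟩ : ∃ k, m = k + 1 := ⟨m - 1, by omega⟩
  exact e.2.1 a

end words

section decomp
set_option linter.unusedSectionVars false
variable {A S : Type} [Semigroup S] [Finite S] {I : Type}

/-- the tuple `w` has content `B` -/
def Cn (B : Finset A) (w : I → List A) : Prop := ∀ i a, a ∈ w i ↔ a ∈ B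

/-- bounded plan -/
def BP {G : Type} [Group G] (ψ : A → S) (p : A → G) (M : ℕ) (w : I → List A) : Prop :=
  ∃ b n, n ≤ M ∧ Plan ψ p b n w

/-- decomposition hypothesis -/
def DD (I : Type) (ψ : A → S) (N M b : ℕ) : Prop :=
  ∀ (G : Type) [Group G] (p : A → G) (B : Finset A), B.card ≤ b → ∀ w : I → List A,
    (∀ i, w i ≠ []) → Cn B w → (∀ i j, Eqv p N (w i) (w j)) → BP ψ p M w

variable {ψ : A → S} {G : Type} [Group G] {p : A → G}

lemma BP.mono {M M' : ℕ} {w : I → List A} (h : BP ψ p M w) (hM : M ≤ M') : BP ψ p M' w := by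
  obtain ⟨b, n, h1, h2⟩ := h
  exact ⟨b, n, h1.trans hM, h2⟩

lemma BP.mul {M M' : ℕ} {u v : I → List A} (h : BP ψ p M u) (h' : BP ψ p M' v) :
    BP ψ p (M + M') (fun i => u i ++ v i) := by
  obtain ⟨b, n, h1, h2⟩ := h
  obtain ⟨b', n', h1', h2'⟩ := h'
  exact ⟨_, _, by omega, Plan.mul h2 h2'⟩

lemma BP.letter (a : A) : BP ψ p 1 (fun _ : I => [a]) := ⟨_, _, le_rfl, Plan.letter a⟩

lemma BP.const {M : ℕ} {w : I → List A} (h : BP ψ p M w) : ∀ i j, wp p (w i) = wp p (w j) := by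
  obtain ⟨b, n, h1, h2⟩ := h
  exact plan_const h2

/-- a block -/
def Blk (ψ : A → S) (p : A → G) (M0 : ℕ) (B : Finset A) (z : I → List A) : Prop :=
  BP ψ p (M0 + 1) z ∧ Cn B z

lemma block_left [Nonempty I] {N0 M0 b : ℕ} (hD : DD I ψ N0 M0 b) {B : Finset A}
    (hB : B.card ≤ b + 1) (hBn : B.Nonempty) {w : I → List A} {n : ℕ} (hn : N0 ≤ n) (hn1 : 1 ≤ n)
    (hc : Cn B w) (he : ∀ i j, Eqv p (n + 1) (w i) (w j)) :
    ∃ z v : I → List A, w = (fun i => z i ++ v i) ∧ Blk ψ p M0 B z ∧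
      (∀ i j, Eqv p n (v i) (v j)) ∧ ∀ i k, HB B (k + 1) (w i) → HB B k (v i) := by
  let i0 : I := Classical.arbitrary I
  obtain ⟨b0, hb0⟩ := hBn
  have hne : w i0 ≠ [] := by
    intro h
    have := (hc i0 b0).2 hb0
    simp [h] at this
  obtain ⟨u0, a, v0, h1, h2, h3⟩ := last_first (w i0) hne
  have haB : a ∈ B := (hc i0 a).1 (by simp [h1])
  choose u v h4 h5 using fun i => first_occ ((hc i a).2 haB)
  have hE : ∀ i j, Eqv p n (u i) (u j) ∧ Eqv p n (v i) (v j) := fun i j =>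
    (he i j).2.2.1 a _ _ _ _ (h4 i) (h4 j) (h5 i) (h5 j)
  have hE0 : ∀ i, Eqv p n u0 (u i) := fun i =>
    ((he i0 i).2.2.1 a _ _ _ _ h1 (h4 i) h2 (h5 i)).1
  have hcu : Cn (B.erase a) u := by
    intro i x
    rw [← Eqv_mem hn1 (hE0 i) x, Finset.mem_erase]
    constructor
    · intro hx
      refine ⟨fun h => h2 (h ▸ hx), (hc i0 x).1 ?_⟩
      rw [h1]; simp [hx]
    · rintro ⟨hx, hxB⟩
      rcases h3 x ((hc i0 x).2 hxB) with h | h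
      · exact h
      · exact absurd h hx
  refine ⟨fun i => u i ++ [a], v, ?_, ⟨?_, ?_⟩, fun i j => (hE i j).2, ?_⟩
  · funext i; rw [h4 i]; simp
  · by_cases hemp : B.erase a = ∅
    · have : u = fun _ => [] := by
        funext i
        rw [List.eq_nil_iff_forall_not_mem]
        intro x hx
        have := (hcu i x).1 hx
        simp [hemp] at this
      subst this
      exact (BP.letter a).mono (by omega)
    · obtain ⟨x, hx⟩ := Finset.nonempty_iff_ne_empty.2 hemp
      refine BP.mul (hD G p (B.erase a) ?_ u ?_ hcu ?_) (BP.letter a)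
      · rw [Finset.card_erase_of_mem haB]; omega
      · intro i hi
        have := (hcu i x).2 hx
        simp [hi] at this
      · exact fun i j => Eqv_mono hn (hE i j).1
  · intro i x
    simp only [List.mem_append, List.mem_singleton, hcu i x, Finset.mem_erase]
    constructor
    · rintro (h | rfl)
      · exact h.2
      · exact haB
    · intro h
      by_cases hx : x = a
      · exact Or.inr hx
      · exact Or.inl ⟨hx, h⟩
  · intro i k h
    rw [h4 i] at h
    exact HB_popl haB (h5 i) h

lemma block_right [Nonempty I] {N0 M0 b : ℕ} (hD : DD I ψ N0 M0 b) {B : Finset A}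
    (hB : B.card ≤ b + 1) (hBn : B.Nonempty) {w : I → List A} {n : ℕ} (hn : N0 ≤ n) (hn1 : 1 ≤ n)
    (hc : Cn B w) (he : ∀ i j, Eqv p (n + 1) (w i) (w j)) :
    ∃ z v : I → List A, w = (fun i => v i ++ z i) ∧ Blk ψ p M0 B z ∧
      (∀ i j, Eqv p n (v i) (v j)) ∧ ∀ i k, HB B (k + 1) (w i) → HB B k (v i) := by
  let i0 : I := Classical.arbitrary I
  obtain ⟨b0, hb0⟩ := hBn
  have hne : w i0 ≠ [] := by
    intro h
    have := (hc i0 b0).2 hb0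
    simp [h] at this
  obtain ⟨v0, a, u0, h1, h2, h3⟩ := first_last (w i0) hne
  have haB : a ∈ B := (hc i0 a).1 (by simp [h1])
  choose v u h4 h5 using fun i => last_occ ((hc i a).2 haB)
  have hE : ∀ i j, Eqv p n (v i) (v j) ∧ Eqv p n (u i) (u j) := fun i j =>
    (he i j).2.2.2 a _ _ _ _ (h4 i) (h4 j) (h5 i) (h5 j)
  have hE0 : ∀ i, Eqv p n u0 (u i) := fun i =>
    ((he i0 i).2.2.2 a _ _ _ _ h1 (h4 i) h2 (h5 i)).2
  have hcu : Cn (B.erase a) u := by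
    intro i x
    rw [← Eqv_mem hn1 (hE0 i) x, Finset.mem_erase]
    constructor
    · intro hx
      refine ⟨fun h => h2 (h ▸ hx), (hc i0 x).1 ?_⟩
      rw [h1]; simp [hx]
    · rintro ⟨hx, hxB⟩
      rcases h3 x ((hc i0 x).2 hxB) with h | h
      · exact h
      · exact absurd h hx
  refine ⟨fun i => [a] ++ u i, v, ?_, ⟨?_, ?_⟩, fun i j => (hE i j).1, ?_⟩
  · funext i; rw [h4 i]; simp
  · by_cases hemp : B.erase a = ∅
    · have : u = fun _ => [] := by
        funext i
        rw [List.eq_nil_iff_forall_not_mem]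
        intro x hx
        have := (hcu i x).1 hx
        simp [hemp] at this
      subst this
      exact (BP.letter a).mono (by omega)
    · obtain ⟨x, hx⟩ := Finset.nonempty_iff_ne_empty.2 hemp
      rw [add_comm]
      refine BP.mul (BP.letter a) (hD G p (B.erase a) ?_ u ?_ hcu ?_)
      · rw [Finset.card_erase_of_mem haB]; omega
      · intro i hi
        have := (hcu i x).2 hx
        simp [hi] at this
      · exact fun i j => Eqv_mono hn (hE i j).2
  · intro i x
    simp only [List.mem_append, List.mem_singleton, hcu i x, Finset.mem_erase]
    constructor
    · rintro (rfl | h)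
      · exact haB
      · exact h.2
    · intro h
      by_cases hx : x = a
      · exact Or.inl hx
      · exact Or.inr ⟨hx, h⟩
  · intro i k h
    rw [h4 i] at h
    exact HB_popr haB (h5 i) h

lemma few_blocks [Nonempty I] {N0 M0 b : ℕ} (hD : DD I ψ N0 M0 b) {B : Finset A}
    (hB : B.card ≤ b + 1) {n : ℕ} (hn : N0 ≤ n) (hn1 : 1 ≤ n) (k : ℕ) :
    ∀ (C : Finset A) (w : I → List A), C ⊆ B → (∀ i, w i ≠ []) → Cn C w →
      (∀ i j, Eqv p (n + k) (w i) (w j)) → (∀ i, ¬ HB B k (w i)) →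
      BP ψ p (k * (M0 + 1) + M0) w := by
  induction k with
  | zero =>
    intro C w _ _ _ _ h
    exact absurd (HB_zero B _) (h (Classical.arbitrary I))
  | succ k ih =>
    intro C w hCB hne hc he hno
    by_cases hCe : C = B
    · subst hCe
      have hCn : C.Nonempty := by
        obtain ⟨x, hx⟩ := List.exists_mem_of_ne_nil _ (hne (Classical.arbitrary I))
        exact ⟨x, (hc _ x).1 hx⟩
      obtain ⟨z, v, rfl, hz, hv, -⟩ := block_left hD hB hCn (n := n + k) (by omega) (by omega) hc he
      have hvm : ∀ i j a, a ∈ v i ↔ a ∈ v j := fun i j => Eqv_mem (by omega) (hv i j)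
      by_cases hemp : v (Classical.arbitrary I) = []
      · have : v = fun _ => [] := by
          funext i
          rw [List.eq_nil_iff_forall_not_mem]
          intro x hx
          have := (hvm i (Classical.arbitrary I) x).1 hx
          simp [hemp] at this
        subst this
        simp only [List.append_nil]
        refine hz.1.mono ?_
        rw [add_mul]; omega
      · have h1 := ih (v (Classical.arbitrary I)).toFinset v ?_ ?_ ?_ hv ?_
        · refine (hz.1.mul h1).mono ?_
          rw [add_mul]; omega
        · intro x hx
          refine (hc (Classical.arbitrary I) x).1 ?_
          simp only [List.mem_toFinset] at hx
          simp [hx]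
        · intro i hi
          obtain ⟨x, hx⟩ := List.exists_mem_of_ne_nil _ hemp
          have := (hvm _ i x).1 hx
          simp [hi] at this
        · intro i a
          rw [List.mem_toFinset]
          exact hvm _ _ a
        · intro i hi
          exact hno i (HB_cons (fun b hb => (hz.2 i b).2 hb) hi)
    · have hlt : C.card < B.card := Finset.card_lt_card (hCB.ssubset_of_ne hCe)
      exact (hD G p C (by omega) w hne hc (fun i j => Eqv_mono (by omega) (he i j))).mono (by omega)

/-- concatenation of a list of tuples -/
def cat (Z : List (I → List A)) (i : I) : List A := (Z.map (fun z => z i)).flatten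

@[simp] lemma cat_nil (i : I) : cat ([] : List (I → List A)) i = [] := rfl
@[simp] lemma cat_cons (z : I → List A) (Z : List (I → List A)) (i : I) :
    cat (z :: Z) i = z i ++ cat Z i := by simp [cat]
@[simp] lemma cat_append (Z Z' : List (I → List A)) (i : I) :
    cat (Z ++ Z') i = cat Z i ++ cat Z' i := by simp [cat]

lemma cat_BP {M0 : ℕ} {B : Finset A} (Z : List (I → List A)) (h0 : Z ≠ [])
    (hZ : ∀ z ∈ Z, Blk ψ p M0 B z) : BP ψ p (Z.length * (M0 + 1)) (cat Z) ∧ Cn B (cat Z) := by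
  induction Z with
  | nil => exact absurd rfl h0
  | cons z Z ih =>
    have hz := hZ z (by simp)
    have e : cat (z :: Z) = fun i => z i ++ cat Z i := by funext i; simp
    by_cases h : Z = []
    · subst h
      have e' : cat [z] = z := by funext i; simp
      rw [e']
      exact ⟨hz.1.mono (by simp), hz.2⟩
    · obtain ⟨h1, h2⟩ := ih h (fun y hy => hZ y (by simp [hy]))
      rw [e]
      refine ⟨(hz.1.mul h1).mono ?_, ?_⟩
      · rw [List.length_cons, add_mul]; omega
      · intro i a
        rw [List.mem_append, hz.2 i a, h2 i a, or_self]

lemma cat_sub {M0 : ℕ} {B : Finset A} (Z : List (I → List A))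
    (hZ : ∀ z ∈ Z, Blk ψ p M0 B z) : (∀ i, ∀ a ∈ cat Z i, a ∈ B) ∧
      (∀ i j, wp p (cat Z i) = wp p (cat Z j)) := by
  by_cases h : Z = []
  · subst h; simp
  · obtain ⟨h1, h2⟩ := cat_BP Z h hZ
    exact ⟨fun i a => (h2 i a).1, h1.const⟩

lemma content_of_HB {B : Finset A} {w : I → List A} {i : I} {k : ℕ} {n : ℕ} (hn : 1 ≤ n)
    (hs : ∀ i, ∀ a ∈ w i, a ∈ B) (he : ∀ i j, Eqv p n (w i) (w j)) (h : HB B (k + 1) (w i)) :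
    Cn B w := fun j a => ⟨hs j a, fun ha => (Eqv_mem hn (he i j) a).1 (HB_mem h a ha)⟩

lemma strip_left [Nonempty I] {N0 M0 b : ℕ} (hD : DD I ψ N0 M0 b) {B : Finset A}
    (hB : B.card ≤ b + 1) (hBn : B.Nonempty) {n : ℕ} (hn : N0 ≤ n) (hn1 : 1 ≤ n) (i : I) (l k : ℕ) :
    ∀ (w : I → List A), (∀ i, ∀ a ∈ w i, a ∈ B) →
      (∀ i j, Eqv p (n + k) (w i) (w j)) → HB B (l + k) (w i) →
      ∃ (Z : List (I → List A)) (v : I → List A), Z.length = k ∧ (∀ z ∈ Z, Blk ψ p M0 B z) ∧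
        w = (fun i => cat Z i ++ v i) ∧ (∀ i j, Eqv p n (v i) (v j)) ∧ HB B l (v i) := by
  induction k with
  | zero =>
    intro w hs he hh
    exact ⟨[], w, rfl, by simp, by simp, he, hh⟩
  | succ k ih =>
    intro w hs he hh
    obtain ⟨z, v, rfl, hz, hv, hv'⟩ := block_left hD hB hBn (n := n + k) (by omega) (by omega)
      (content_of_HB (n := n + (k + 1)) (by omega) hs he hh) he
    obtain ⟨Z, v', h1, h2, rfl, h4, h5⟩ := ih v (fun i a ha => hs i a (by simp [ha])) hv
      (hv' i _ hh)
    exact ⟨z :: Z, v', by simp [h1], by simpa using ⟨hz, h2⟩, by simp, h4, h5⟩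

lemma strip_right [Nonempty I] {N0 M0 b : ℕ} (hD : DD I ψ N0 M0 b) {B : Finset A}
    (hB : B.card ≤ b + 1) (hBn : B.Nonempty) {n : ℕ} (hn : N0 ≤ n) (hn1 : 1 ≤ n) (i : I) (l k : ℕ) :
    ∀ (w : I → List A), (∀ i, ∀ a ∈ w i, a ∈ B) →
      (∀ i j, Eqv p (n + k) (w i) (w j)) → HB B (l + k) (w i) →
      ∃ (Z : List (I → List A)) (v : I → List A), Z.length = k ∧ (∀ z ∈ Z, Blk ψ p M0 B z) ∧
        w = (fun i => v i ++ cat Z i) ∧ (∀ i j, Eqv p n (v i) (v j)) ∧ HB B l (v i) := by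
  induction k with
  | zero =>
    intro w hs he hh
    exact ⟨[], w, rfl, by simp, by simp, he, hh⟩
  | succ k ih =>
    intro w hs he hh
    obtain ⟨z, v, rfl, hz, hv, hv'⟩ := block_right hD hB hBn (n := n + k) (by omega) (by omega)
      (content_of_HB (n := n + (k + 1)) (by omega) hs he hh) he
    obtain ⟨Z, v', h1, h2, rfl, h4, h5⟩ := ih v (fun i a ha => hs i a (by simp [ha])) hv
      (hv' i _ hh)
    refine ⟨Z ++ [z], v', by simp [h1], ?_, by simp, h4, h5⟩
    intro y hy
    rcases List.mem_append.1 hy with hy | hy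
    · exact h2 y hy
    · rw [List.mem_singleton.1 hy]; exact hz

lemma pigeon {X F : Type} [Finite F] (g : List X → F) (Z : List X) (hZ : Nat.card F + 1 ≤ Z.length) :
    ∃ Z1 Z2 Z3, Z = Z1 ++ Z2 ++ Z3 ∧ Z1 ≠ [] ∧ Z2 ≠ [] ∧ g Z1 = g (Z1 ++ Z2) := by
  have := Fintype.ofFinite F
  obtain ⟨x, y, hxy, h⟩ := Fintype.exists_ne_map_eq_of_card_lt
    (fun j : Fin (Nat.card F + 1) => g (Z.take (j.1 + 1))) (by simp [Nat.card_eq_fintype_card])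
  wlog hlt : x < y generalizing x y
  · exact this y x hxy.symm h.symm (lt_of_le_of_ne (not_lt.1 hlt) hxy.symm)
  have hy := y.2
  have hlt' : x.1 < y.1 := hlt
  have e : Z.take (x.1 + 1) ++ (Z.take (y.1 + 1)).drop (x.1 + 1) = Z.take (y.1 + 1) := by
    conv_rhs => rw [← List.take_append_drop (x.1 + 1) (Z.take (y.1 + 1))]
    rw [List.take_take, min_eq_left (by omega)]
  refine ⟨Z.take (x.1 + 1), (Z.take (y.1 + 1)).drop (x.1 + 1), Z.drop (y.1 + 1), ?_, ?_, ?_, ?_⟩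
  · rw [e, List.take_append_drop]
  · intro h0
    have := congrArg List.length h0
    simp only [List.length_take, List.length_nil] at this
    omega
  · intro h0
    have := congrArg List.length h0
    simp only [List.length_drop, List.length_take, List.length_nil] at this
    omega
  · rw [e]; exact h

lemma pigeon_right {X F : Type} [Finite F] (g : List X → F) (Z : List X)
    (hZ : Nat.card F + 1 ≤ Z.length) :
    ∃ Z1 Z2 Z3, Z = Z3 ++ Z2 ++ Z1 ∧ Z1 ≠ [] ∧ Z2 ≠ [] ∧ g Z1 = g (Z2 ++ Z1) := by
  obtain ⟨Z1, Z2, Z3, h1, h2, h3, h4⟩ := pigeon (fun L => g L.reverse) Z.reverse (by simpa using hZ)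
  refine ⟨Z1.reverse, Z2.reverse, Z3.reverse, ?_, by simpa using h2, by simpa using h3, ?_⟩
  · rw [← List.reverse_reverse Z, h1]; simp
  · simpa using h4

lemma many_blocks [Finite I] [Nonempty I] {N0 M0 b K : ℕ} (hK : Nat.card (I → WithOne S) + 1 = K)
    (hD : DD I ψ N0 M0 b) {B : Finset A}
    (hB : B.card ≤ b + 1) (hBn : B.Nonempty) {n : ℕ} (hn : N0 ≤ n) (hn1 : 1 ≤ n) (i : I)
    (w : I → List A) (hc : ∀ i, ∀ a ∈ w i, a ∈ B)
    (he : ∀ i j, Eqv p (n + K + K) (w i) (w j)) (hh : HB B (1 + K + K) (w i)) :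
    ∃ n ≤ 4 * (K * (M0 + 1)) + 1, Plan ψ p true n w := by
  obtain ⟨Z, v, a1, a2, rfl, a4, a5⟩ := strip_left hD hB hBn (n := n + K) (by omega) (by omega) i
    (1 + K) K w hc he hh
  obtain ⟨Y, m, b1, b2, rfl, b4, b5⟩ := strip_right hD hB hBn (n := n) (by omega) (by omega) i
    1 K v (fun i a ha => hc i a (by simp [ha])) a4 a5
  obtain ⟨Z1, Z2, Z3, rfl, c1, c2, c3⟩ := pigeon (fun L (i : I) => wp (lS ψ) (cat L i)) Z
    (by omega)
  obtain ⟨Y1, Y2, Y3, rfl, d1, d2, d3⟩ := pigeon_right (fun L (i : I) => wp (lS ψ) (cat L i)) Y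
    (by omega)
  obtain ⟨⟨_, n1, e1, e1'⟩, f1⟩ := cat_BP Z1 c1 (fun z hz => a2 z (by simp [hz]))
  obtain ⟨⟨_, n2, e2, e2'⟩, f2⟩ := cat_BP Z2 c2 (fun z hz => a2 z (by simp [hz]))
  obtain ⟨⟨_, n3, e3, e3'⟩, f3⟩ := cat_BP Y1 d1 (fun z hz => b2 z (by simp [hz]))
  obtain ⟨⟨_, n4, e4, e4'⟩, f4⟩ := cat_BP Y2 d2 (fun z hz => b2 z (by simp [hz]))
  obtain ⟨g1, g2⟩ := cat_sub Z3 (fun z hz => a2 z (by simp [hz]))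
  obtain ⟨k1, k2⟩ := cat_sub Y3 (fun z hz => b2 z (by simp [hz]))
  have hCm : Cn B m := content_of_HB (k := 0) hn1 (fun i a ha => hc i a (by simp [ha])) b4 b5
  have hsize : ∀ L : List (I → List A), L.length ≤ K →
      L.length * (M0 + 1) ≤ K * (M0 + 1) := fun L hL => Nat.mul_le_mul_right _ hL
  have := hsize Z1 (by simp at a1; omega)
  have := hsize Z2 (by simp at a1; omega)
  have := hsize Y1 (by simp at b1; omega)
  have := hsize Y2 (by simp at b1; omega)
  have hset : ∀ {z : I → List A}, Cn B z → ∀ i, {a | a ∈ z i} = (B : Set A) := fun hz i => by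
    ext a; exact hz i a
  have key := Plan.reg (fun i => cat Z3 i ++ (m i ++ cat Y3 i)) (B : Set A) e1' e2' e4' e3' ?_ ?_
    (hset f2) (hset f4) (fun i => (hset f1 i).subset) (fun i => (hset f3 i).subset) ?_ ?_ ?_
  · refine ⟨n1 + n2 + n4 + n3 + 1, by omega, ?_⟩
    convert key using 1
    funext i; simp
  · intro i hi
    obtain ⟨x, hx⟩ := hBn
    have := (hCm i x).2 hx
    simp only [List.append_eq_nil_iff] at hi
    simp [hi.2.1] at this
  · intro i j
    simp only [wp_append]
    rw [g2 i j, k2 i j, Eqv_wp (b4 i j)]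
  · intro i a ha
    have ha' : a ∈ cat Z3 i ++ (m i ++ cat Y3 i) := ha
    simp only [List.mem_append] at ha'
    rcases ha' with h | h | h
    · exact g1 i a h
    · exact (hCm i a).1 h
    · exact k1 i a h
  · intro i
    have := congrFun c3 i
    simp only [cat_append, wp_append] at this
    exact this.symm
  · intro i
    have := congrFun d3 i
    simp only [cat_append, wp_append] at this
    exact this.symm

lemma decomp (I : Type) [Finite I] [Nonempty I] {K : ℕ} (hK : Nat.card (I → WithOne S) + 1 = K)
    (ψ : A → S) (b : ℕ) : ∃ N M, DD I ψ N M b ∧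
    ∀ (G : Type) [Group G] (p : A → G) (B : Finset A), B.card ≤ b → ∀ w : I → List A,
    (∀ i, w i ≠ []) → Cn B w → (∀ i j, Eqv p N (w i) (w j)) → (∃ i, HB B (1 + K + K) (w i)) →
    ∃ n ≤ M, Plan ψ p true n w := by
  induction b with
  | zero =>
    have key : ∀ (B : Finset A), B.card ≤ 0 → ∀ w : I → List A,
        (∀ i, w i ≠ []) → Cn B w → False := by
      intro B hB w hw hc
      obtain ⟨x, hx⟩ := List.exists_mem_of_ne_nil _ (hw (Classical.arbitrary I))
      have := (hc _ x).1 hx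
      simp at hB
      simp [hB] at this
    exact ⟨0, 0, fun G _ p B hB w hw hc => (key B hB w hw hc).elim,
      fun G _ p B hB w hw hc => (key B hB w hw hc).elim⟩
  | succ b ih =>
    obtain ⟨N0, M0, hD, -⟩ := ih
    set M1 := max (4 * (K * (M0 + 1)) + 1) ((1 + K + K) * (M0 + 1) + M0) with hM1
    have main : ∀ (G : Type) [Group G] (p : A → G) (B : Finset A), B.card ≤ b + 1 →
        ∀ w : I → List A, (∀ i, w i ≠ []) → Cn B w →
        (∀ i j, Eqv p (N0 + 1 + (1 + K + K)) (w i) (w j)) → (∃ i, HB B (1 + K + K) (w i)) →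
        ∃ n ≤ M1, Plan ψ p true n w := by
      intro G _ p B hB w hne hc he hi
      obtain ⟨i, hi⟩ := hi
      have hBn : B.Nonempty := by
        obtain ⟨x, hx⟩ := List.exists_mem_of_ne_nil _ (hne i)
        exact ⟨x, (hc _ x).1 hx⟩
      obtain ⟨n, h1, h2⟩ := many_blocks hK hD hB hBn (n := N0 + 1) (by omega) (by omega) i w
        (fun i a => (hc i a).1) (fun i j => Eqv_mono (by omega) (he i j)) hi
      exact ⟨n, h1.trans (le_max_left _ _), h2⟩
    refine ⟨N0 + 1 + (1 + K + K), M1, ?_, main⟩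
    intro G _ p B hB w hne hc he
    by_cases hi : ∃ i, HB B (1 + K + K) (w i)
    · obtain ⟨n, h1, h2⟩ := main G p B hB w hne hc he hi
      exact ⟨_, n, h1, h2⟩
    · push Not at hi
      exact (few_blocks hD hB (n := N0 + 1) (by omega) (by omega) (1 + K + K) B w subset_rfl hne hc
        he hi).mono (le_max_right _ _)

end decomp
end DOPart


namespace DOPart
open Classical
open AshPart

/-- the list of letters of an element of the free semigroup -/
def toL {A : Type} (x : FreeSemigroup A) : List A := x.head :: x.tail

lemma toL_mul {A : Type} (x y : FreeSemigroup A) : toL (x * y) = toL x ++ toL y := by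
  simp [toL]

lemma toL_wp {A S : Type} [Semigroup S] (φ : FreeSemigroup A →ₙ* S) (x : FreeSemigroup A) :
    wp (lS (fun a => φ (FreeSemigroup.of a))) (toL x) = ((φ x : S) : WithOne S) := by
  induction x using FreeSemigroup.recOnMul with
  | ih1 a => simp [toL, lS]
  | ih2 x y h1 h2 => rw [toL_mul, wp_append, h2, map_mul, WithOne.coe_mul, h1]

lemma wp_rep {A M : Type} [Monoid M] (f : A → M) (w : List A)
    (h : IsIdempotentElem (wp f w)) (L : ℕ) :
    wp f (List.replicate (L + 1) w).flatten = wp f w := by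
  induction L with
  | zero => simp
  | succ L ih =>
    rw [List.replicate_succ, List.flatten_cons, wp_append, ih]
    exact h

lemma mem_rep {A : Type} (w : List A) (L : ℕ) (a : A) :
    a ∈ (List.replicate (L + 1) w).flatten ↔ a ∈ w := by
  simp

theorem final {S : Type} [Semigroup S] [Finite S]
    (P : Set S) (hP : IsDOIdempotentPointlike P)
    (A : Type) [Finite A]
    (φ : FreeSemigroup A →ₙ* S) (hφ : Function.Surjective φ) :
    ∃ w : P → KTerm A,
      (∀ p : P, KEval (fun a => φ (FreeSemigroup.of a)) (w p) (p : S)) ∧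
      (∀ (T : Type) [Semigroup T] [Finite T], InDO T →
        ∀ f : A → T, ∃ t : T, IsIdempotentElem t ∧ ∀ p : P, KEval f (w p) t) := by
  rcases Set.eq_empty_or_nonempty P with rfl | ⟨q0, hq0⟩
  · refine ⟨fun p => absurd p.2 (Set.notMem_empty _), fun p => absurd p.2 (Set.notMem_empty _), ?_⟩
    intro T _ _ hT f
    have hA : Nonempty A := by
      by_contra hA
      have hS : S → False := fun s => by
        obtain ⟨x, -⟩ := hφ s
        exact hA ⟨x.head⟩
      let _ : Semigroup Empty := { mul := fun x _ => x, mul_assoc := fun x => x.elim }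
      obtain ⟨t, -⟩ := hP Empty (fun s => s.elim) ⊤ (fun s => (hS s).elim)
      exact t.elim
    obtain ⟨a⟩ := hA
    obtain ⟨g, e, he, -⟩ := exists_om1 (f a)
    exact ⟨e, he, fun p => absurd p.2 (Set.notMem_empty _)⟩
  · set ψ : A → S := fun a => φ (FreeSemigroup.of a) with hψ
    have := Fintype.ofFinite A
    obtain ⟨N, M, -, hD⟩ := decomp (Option P) (K := _) rfl ψ (Fintype.card A)
    set K := Nat.card (Option P → WithOne S) + 1 with hK
    set c := (Nat.card (Option P) + 1) * (2 * Nat.card (St A S)) with hc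
    obtain ⟨G, i1, i2, p, hp⟩ := ash (gstep ψ) (c * M)
    obtain ⟨Mo, j1, j2, f, hort, hf⟩ := exists_monoid p (N + 1)
    let R : Subsemigroup (S × Mo) :=
      { carrier := {z | ∃ x : FreeSemigroup A, φ x = z.1 ∧ wp f (toL x) = z.2}
        mul_mem' := by
          rintro ⟨s, m⟩ ⟨s', m'⟩ ⟨x, h1, h2⟩ ⟨y, h3, h4⟩
          refine ⟨x * y, ?_, ?_⟩
          · rw [map_mul, h1, h3]; rfl
          · rw [toL_mul, wp_append, h2, h4]; rfl }
    obtain ⟨t, ht, hR⟩ := hP Mo (inDO_of_ort hort) R (fun s => by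
      obtain ⟨x, hx⟩ := hφ s
      exact ⟨_, x, hx, rfl⟩)
    choose x hx1 hx2 using fun q : P => hR q.1 q.2
    change ∀ q : P, φ (x q) = q.1 at hx1
    change ∀ q : P, wp f (toL (x q)) = t at hx2
    let x0 := toL (x ⟨q0, hq0⟩)
    have hx0 : wp f x0 = t := hx2 ⟨q0, hq0⟩
    let w : Option P → List A := fun o => match o with
      | none => (List.replicate (1 + K + K) x0).flatten
      | some q => toL (x q)
    obtain ⟨L, hL⟩ : ∃ L, 1 + K + K = L + 1 := ⟨K + K, by omega⟩
    have hw : ∀ o, wp f (w o) = t := by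
      intro o
      rcases o with _ | q
      · change wp f (List.replicate (1 + K + K) x0).flatten = t
        rw [hL, wp_rep f x0 (by rw [hx0]; exact ht), hx0]
      · exact hx2 q
    have hE : ∀ o o', Eqv p (N + 1) (w o) (w o') := fun o o' => hf _ _ ((hw o).trans (hw o').symm)
    have hCn : Cn x0.toFinset w := by
      intro o a
      rw [List.mem_toFinset]
      exact Eqv_mem (by omega) (hE o (some ⟨q0, hq0⟩)) a
    have hne : ∀ o, w o ≠ [] := by
      intro o h
      have := (hCn o (x ⟨q0, hq0⟩).head).2 (by simp [x0, toL])
      simp [h] at this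
    obtain ⟨n, hn, plan⟩ := hD G p x0.toFinset (Finset.card_le_univ _) w hne hCn
      (fun o o' => Eqv_mono (by omega) (hE o o'))
      ⟨none, [], List.replicate (1 + K + K) x0, [], by simp [w], by simp, by
        intro l hl b hb
        rw [List.eq_of_mem_replicate hl]
        simpa using hb⟩
    have hw1 : ∀ o, wp p (w o) = 1 := by
      intro o
      have h1 := Eqv_wp (hf (w o ++ w o) (w o) (by rw [wp_append, hw o]; exact ht))
      rw [wp_append] at h1
      exact mul_eq_left.1 h1
    obtain ⟨E, hEc, hlift⟩ := plan_lift plan 1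
    obtain ⟨σ, hσ⟩ := hp E (hEc.trans (Nat.mul_le_mul_left _ hn))
    obtain ⟨τ, ⟨r1, -, r3, r4⟩, r5⟩ := hlift σ hσ
    refine ⟨fun q => τ (some q), fun q => ?_, fun T _ _ hT g => ?_⟩
    · have h1 := r1 (some q)
      have h2 : wp (lS ψ) (w (some q)) = ((q.1 : S) : WithOne S) := by
        rw [← hx1 q]; exact toL_wp φ (x q)
      rw [h2, WithOne.coe_inj] at h1
      rw [h1]
      exact keval_ev ψ _
    · have hO := ort_of_inDO hT
      refine ⟨ev g (τ none), r5 rfl none ?_ T hO g, fun q => ?_⟩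
      · rw [r3 none]; simp [hw1 none]
      · rw [r4 T hO g none (some q)]
        exact keval_ev g _

end DOPart

/-- The pseudovariety `DO` is κ-reducible for idempotent pointlike sets. -/
theorem DO_kappa_reducible_for_idempotent_pointlikes
    {S : Type} [Semigroup S] [Finite S]
    (P : Set S) (hP : IsDOIdempotentPointlike P)
    (A : Type) [Finite A]
    (φ : FreeSemigroup A →ₙ* S) (hφ : Function.Surjective φ) :
    ∃ w : P → KTerm A,
      (∀ p : P, KEval (fun a => φ (FreeSemigroup.of a)) (w p) (p : S)) ∧
      (∀ (T : Type) [Semigroup T] [Finite T], InDO T →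
        ∀ f : A → T, ∃ t : T, IsIdempotentElem t ∧ ∀ p : P, KEval f (w p) t) := by
  exact DOPart.final P hP A φ hφ
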